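/- arXiv:2008.10500 — 2 statements merged into one kernel-verified Lean document; each statement's English description precedes it below -/
import Mathlib

section
/- Let α > 1 be an irrational real number. Then as n → ∞, p_α(n) = exp(2π·√(n/(6α))) / n^{1 − 1/(4α) + o(1)}; equivalently, (log p_α(n) − 2π·√(n/(6α))) / log n converges to −(1 − 1/(4α)) as n → ∞. -/
open Filter Topology Real

/-- The number of partitions of `n` into parts (repetition allowed) chosen from the Beatty
sequence `(⌊α m⌋)_{m ≥ 1}`. -/
noncomputable def beattyPartitions (α : ℝ) (n : ℕ) : ℕ :=
  Nat.card {P : n.Partition // ∀ j ∈ P.parts, ∃ m : ℕ, 0 < m ∧ (j : ℤ) = ⌊α * m⌋}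

/-- absolutely convergent evaluation of a power series -/
def EvAt (f : PowerSeries ℂ) (z v : ℂ) : Prop :=
  Summable (fun k => ‖PowerSeries.coeff k f * z ^ k‖) ∧ ∑' k, PowerSeries.coeff k f * z ^ k = v

lemma EvAt.mul {f g : PowerSeries ℂ} {z v w : ℂ} (hf : EvAt f z v) (hg : EvAt g z w) :
    EvAt (f * g) z (v * w) := by
  have key : ∀ k, PowerSeries.coeff k (f * g) * z ^ k =
      ∑ kl ∈ Finset.HasAntidiagonal.antidiagonal k, (PowerSeries.coeff kl.1 f * z ^ kl.1) *
        (PowerSeries.coeff kl.2 g * z ^ kl.2) := by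
    intro k
    rw [PowerSeries.coeff_mul, Finset.sum_mul]
    refine Finset.sum_congr rfl fun kl hkl => ?_
    rw [← Finset.HasAntidiagonal.mem_antidiagonal.mp hkl, pow_add]; ring
  have e1 := summable_norm_sum_mul_antidiagonal_of_summable_norm
    (f := fun k => PowerSeries.coeff k f * z ^ k) (g := fun k => PowerSeries.coeff k g * z ^ k)
    hf.1 hg.1
  have e2 := tsum_mul_tsum_eq_tsum_sum_antidiagonal_of_summable_norm
    (f := fun k => PowerSeries.coeff k f * z ^ k) (g := fun k => PowerSeries.coeff k g * z ^ k)
    hf.1 hg.1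
  constructor
  · refine e1.congr fun k => ?_
    rw [key k]
  · rw [tsum_congr key, ← e2, hf.2, hg.2]

lemma EvAt.one (z : ℂ) : EvAt 1 z 1 := by
  have h : ∀ k, k ∉ ({0} : Finset ℕ) → PowerSeries.coeff k (1 : PowerSeries ℂ) * z ^ k = 0 := by
    intro k hk
    have : k ≠ 0 := by simpa using hk
    simp [PowerSeries.coeff_one, this]
  constructor
  · apply summable_of_ne_finset_zero (s := {0})
    intro b hb; rw [h b hb, norm_zero]
  · rw [tsum_eq_sum h]; simp

/-- geometric power series -/
noncomputable def geoPS (a : ℕ) : PowerSeries ℂ :=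
  PowerSeries.mk fun k => if a ∣ k then 1 else 0

lemma EvAt.geo {a : ℕ} (ha : 0 < a) {z : ℂ} (hz : ‖z‖ < 1) : EvAt (geoPS a) z (1 - z ^ a)⁻¹ := by
  have hinj : Function.Injective (fun j : ℕ => a * j) := fun x y h =>
    Nat.eq_of_mul_eq_mul_left ha h
  have hza : ‖z ^ a‖ < 1 := by
    rw [norm_pow]; exact pow_lt_one₀ (norm_nonneg _) hz ha.ne'
  have hs : HasSum (fun j : ℕ => (z ^ a) ^ j) (1 - z ^ a)⁻¹ := hasSum_geometric_of_norm_lt_one hza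
  have hcomp : ∀ j : ℕ, PowerSeries.coeff (a * j) (geoPS a) * z ^ (a * j) = (z ^ a) ^ j := by
    intro j; simp [geoPS, pow_mul]
  have hout : ∀ k, k ∉ Set.range (fun j : ℕ => a * j) →
      PowerSeries.coeff k (geoPS a) * z ^ k = 0 := by
    intro k hk
    have : ¬ a ∣ k := fun ⟨j, hj⟩ => hk ⟨j, hj.symm⟩
    simp [geoPS, this]
  constructor
  · rw [← hinj.summable_iff (f := fun k => ‖PowerSeries.coeff k (geoPS a) * z ^ k‖)]
    · simp only [Function.comp_def, hcomp]
      simp only [norm_pow]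
      exact summable_geometric_of_lt_one (by positivity) (by simpa using hza)
    · intro k hk; rw [hout k hk, norm_zero]
  · apply HasSum.tsum_eq
    rw [← hinj.hasSum_iff hout]
    simpa [Function.comp_def, hcomp] using hs

lemma EvAt.prod {S : Finset ℕ} (hS : ∀ a ∈ S, 0 < a) {z : ℂ} (hz : ‖z‖ < 1) :
    EvAt (∏ a ∈ S, geoPS a) z (∏ a ∈ S, (1 - z ^ a)⁻¹) := by
  induction S using Finset.cons_induction with
  | empty => simpa using EvAt.one z
  | cons a S ha ih =>
    rw [Finset.prod_cons, Finset.prod_cons]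
    exact (EvAt.geo (hS a (by simp)) hz).mul (ih fun b hb => hS b (by simp [hb]))

open scoped PowerSeries.WithPiTopology in
lemma mk_restricted (S : Finset ℕ) (hS : ∀ a ∈ S, 0 < a) :
    PowerSeries.mk (fun n => ((Nat.Partition.restricted n (· ∈ S)).card : ℂ)) =
      ∏ a ∈ S, geoPS a := by
  have h := Nat.Partition.hasProd_powerSeriesMk_card_restricted ℂ (· ∈ S)
  have hgeo : ∀ i : ℕ, ∑' j : ℕ, (PowerSeries.X : PowerSeries ℂ) ^ ((i + 1) * j) = geoPS (i + 1) := by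
    intro i
    apply HasSum.tsum_eq
    rw [PowerSeries.WithPiTopology.hasSum_iff_hasSum_coeff]
    intro d
    simp only [PowerSeries.coeff_X_pow, geoPS, PowerSeries.coeff_mk]
    by_cases hd : (i + 1) ∣ d
    · obtain ⟨c, rfl⟩ := hd
      have := hasSum_ite_eq c (1 : ℂ)
      simpa [eq_comm] using this
    · rw [if_neg hd]
      convert hasSum_zero using 2 with j
      rw [if_neg]; rintro rfl; exact hd ⟨_, rfl⟩
  simp_rw [hgeo] at h
  have h2 : HasProd (fun i : ℕ => if i + 1 ∈ S then geoPS (i + 1) else 1) (∏ a ∈ S, geoPS a) := by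
    have hp := hasProd_prod_of_ne_finset_one (L := SummationFilter.unconditional ℕ) (s := S.image (fun a => a - 1))
      (f := fun i : ℕ => if i + 1 ∈ S then geoPS (i + 1) else 1) (by
        intro b hb
        rw [if_neg]
        intro hb'
        exact hb (Finset.mem_image.mpr ⟨b + 1, hb', by simp⟩))
    convert hp using 1
    rw [Finset.prod_image]
    · refine Finset.prod_congr rfl fun a ha => ?_
      rw [Nat.sub_add_cancel (hS a ha), if_pos ha]
    · intro x hx y hy hxy
      have := hS x hx; have := hS y hy
      simp only at hxy
      omega
  exact h.unique h2

/-- number of partitions with parts in `S` -/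
noncomputable def pcnt (S : Finset ℕ) (n : ℕ) : ℕ := (Nat.Partition.restricted n (· ∈ S)).card

lemma pcnt_ev {S : Finset ℕ} (hS : ∀ a ∈ S, 0 < a) {z : ℂ} (hz : ‖z‖ < 1) :
    Summable (fun k => ‖(pcnt S k : ℂ) * z ^ k‖) ∧
      ∑' k, (pcnt S k : ℂ) * z ^ k = ∏ a ∈ S, (1 - z ^ a)⁻¹ := by
  have := EvAt.prod hS hz
  rw [← mk_restricted S hS] at this
  simpa [EvAt, pcnt] using this

/-- the Beatty sequence -/
noncomputable def bt (α : ℝ) (m : ℕ) : ℕ := ⌊α * m⌋₊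

open Classical in
/-- Beatty parts up to `n` -/
noncomputable def bset (α : ℝ) (n : ℕ) : Finset ℕ :=
  (Finset.Icc 1 n).filter (fun a => ∃ m : ℕ, 0 < m ∧ a = bt α m)

lemma mem_bset {α : ℝ} {n a : ℕ} : a ∈ bset α n ↔ (1 ≤ a ∧ a ≤ n) ∧ ∃ m : ℕ, 0 < m ∧ a = bt α m := by
  simp [bset]

lemma beatty_eq_pcnt {α : ℝ} (hα : 1 < α) (n : ℕ) : beattyPartitions α n = pcnt (bset α n) n := by
  classical
  rw [beattyPartitions, pcnt, Nat.card_eq_fintype_card, Fintype.card_subtype]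
  congr 1
  ext P
  simp only [Nat.Partition.restricted, Finset.mem_filter, Finset.mem_univ, true_and]
  refine forall₂_congr fun j hj => ?_
  have h1 := P.parts_pos hj
  have h2 : j ≤ n := by
    have := Multiset.le_sum_of_mem hj
    rwa [P.parts_sum] at this
  rw [mem_bset]
  have : ∀ m : ℕ, ((j : ℤ) = ⌊α * m⌋ ↔ j = bt α m) := by
    intro m
    have h0 : 0 ≤ α * m := by positivity
    rw [bt, ← Int.natCast_floor_eq_floor h0]
    norm_cast
  simp only [this]
  constructor
  · intro h; exact ⟨⟨h1, h2⟩, h⟩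
  · intro h; exact h.2

/-- mean multiplicity of the part `a` -/
noncomputable def mu (t : ℝ) (a : ℕ) : ℝ := (Real.exp (t * a) - 1)⁻¹

/-- characteristic function of a geometric variable -/
noncomputable def phi1 (t : ℝ) (a : ℕ) (θ : ℝ) : ℂ :=
  (1 + (mu t a : ℂ) * (1 - Complex.exp (Complex.I * (a * θ : ℝ))))⁻¹

/-- log-weight of one part -/
noncomputable def hh (x : ℝ) : ℝ := - Real.log (1 - Real.exp (-x))

/-- log of the generating function -/
noncomputable def HS (S : Finset ℕ) (t : ℝ) : ℝ := ∑ a ∈ S, hh (t * a)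

lemma exp_hh {x : ℝ} (hx : 0 < x) : Real.exp (hh x) = (1 - Real.exp (-x))⁻¹ := by
  have : 0 < 1 - Real.exp (-x) := by
    have := Real.exp_lt_one_iff.mpr (show -x < 0 by linarith); linarith
  rw [hh, Real.exp_neg, Real.exp_log this]

lemma one_sub_inv_eq {t : ℝ} (ht : 0 < t) {a : ℕ} (ha : 0 < a) (θ : ℝ) :
    (1 - Complex.exp (-t + Complex.I * θ) ^ a)⁻¹ =
      (Real.exp (hh (t * a)) : ℂ) * phi1 t a θ := by
  have hta : 0 < t * a := by positivity
  have h1 : Real.exp (-(t * a)) < 1 := Real.exp_lt_one_iff.mpr (by linarith)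
  have h2 : 0 < Real.exp (-(t * a)) := Real.exp_pos _
  rw [exp_hh hta, phi1, ← Complex.exp_nat_mul]
  have h3 : Complex.exp (a * (-t + Complex.I * θ)) =
      (Real.exp (-(t * a)) : ℂ) * Complex.exp (Complex.I * (a * θ : ℝ)) := by
    rw [Complex.ofReal_exp, ← Complex.exp_add]; congr 1; push_cast; ring
  rw [h3]
  set w := Complex.exp (Complex.I * (a * θ : ℝ))
  have h4 : mu t a * (1 - Real.exp (-(t * a))) = Real.exp (-(t * a)) := by
    have : Real.exp (t * a) = (Real.exp (-(t * a)))⁻¹ := by rw [Real.exp_neg, inv_inv]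
    rw [mu, this]
    field_simp
    rw [div_self]; linarith
  set ρ := Real.exp (-(t * a))
  have h5 : (mu t a : ℂ) * (1 - (ρ : ℂ)) = ρ := by exact_mod_cast h4
  push_cast
  rw [← mul_inv]
  congr 1
  linear_combination (w - 1) * h5

lemma fourier_coeff_zero (k n : ℕ) :
    ∫ θ in (-π)..π, Complex.exp (Complex.I * ((k : ℂ) - n) * θ) =
      if k = n then (2 * π : ℂ) else 0 := by
  split_ifs with h
  · subst h
    simp; ring
  · have hc : Complex.I * ((k : ℂ) - n) ≠ 0 := by
      apply mul_ne_zero Complex.I_ne_zero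
      rw [sub_ne_zero]; exact_mod_cast h
    rw [integral_exp_mul_complex hc]
    have : Complex.exp (Complex.I * ((k : ℂ) - n) * π) =
        Complex.exp (Complex.I * ((k : ℂ) - n) * ((-π : ℝ) : ℂ)) := by
      rw [Complex.exp_eq_exp_iff_exists_int]
      refine ⟨(k : ℤ) - n, ?_⟩
      push_cast; ring
    rw [this]; simp

lemma pcnt_fourier {S : Finset ℕ} (hS : ∀ a ∈ S, 0 < a) (n : ℕ) {t : ℝ} (ht : 0 < t) :
    (pcnt S n : ℂ) = (Real.exp (HS S t + n * t) / (2 * π) : ℝ) *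
      ∫ θ in (-π)..π, (∏ a ∈ S, phi1 t a θ) * Complex.exp (-(Complex.I * (n * θ))) := by
  have hz : ∀ θ : ℝ, ‖Complex.exp (-t + Complex.I * θ)‖ = Real.exp (-t) := by
    intro θ; rw [Complex.norm_exp]; simp
  have hlt : Real.exp (-t) < 1 := Real.exp_lt_one_iff.mpr (by linarith)
  have hev := fun θ : ℝ => pcnt_ev hS (z := Complex.exp (-t + Complex.I * θ)) (by rw [hz]; exact hlt)
  have hpow : ∀ (k : ℕ) (θ : ℝ), (pcnt S k : ℂ) * Complex.exp (-t + Complex.I * θ) ^ k *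
      Complex.exp (-(Complex.I * (n * θ))) = ((pcnt S k : ℂ) * Real.exp (-(t * k))) *
        Complex.exp (Complex.I * ((k : ℂ) - n) * θ) := by
    intro k θ
    rw [← Complex.exp_nat_mul, Complex.ofReal_exp, mul_assoc, mul_assoc, ← Complex.exp_add,
      ← Complex.exp_add]
    congr 2
    push_cast; ring
  let f : ℕ → C(ℝ, ℂ) := fun k => ⟨fun θ => ((pcnt S k : ℂ) * Real.exp (-(t * k))) *
        Complex.exp (Complex.I * ((k : ℂ) - n) * θ), by fun_prop⟩
  have hnorm : ∀ (k : ℕ) (θ : ℝ), ‖f k θ‖ = pcnt S k * Real.exp (-(t * k)) := by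
    intro k θ
    simp only [f, ContinuousMap.coe_mk, norm_mul, Complex.norm_exp]
    have : (Complex.I * ((k : ℂ) - n) * θ).re = 0 := by simp
    rw [this]
    simp [abs_of_pos (Real.exp_pos _), Complex.norm_real, -Complex.ofReal_exp]
  have hsumm : Summable (fun k : ℕ => (pcnt S k : ℝ) * Real.exp (-(t * k))) := by
    have := (hev 0).1
    refine this.congr fun k => ?_
    rw [norm_mul, norm_pow, hz, ← Real.exp_nat_mul]
    simp; left; ring
  have hsumint := intervalIntegral.hasSum_intervalIntegral_of_summable_norm (a := -π) (b := π) (f := f)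
    (by
      refine Summable.of_nonneg_of_le (fun k => norm_nonneg _) (fun k => ?_) hsumm
      refine (ContinuousMap.norm_le _ (by positivity)).mpr fun x => ?_
      rw [ContinuousMap.restrict_apply, hnorm])
  have hterm : ∀ k, ∫ θ in (-π)..π, f k θ =
      if k = n then (pcnt S n : ℂ) * Real.exp (-(t * n)) * (2 * π) else 0 := by
    intro k
    simp only [f, ContinuousMap.coe_mk]
    rw [intervalIntegral.integral_const_mul, fourier_coeff_zero]
    split_ifs with h
    · rw [h]
    · simp
  simp_rw [hterm] at hsumint
  have huniq := hsumint.unique (by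
    have := hasSum_ite_eq n ((pcnt S n : ℂ) * Real.exp (-(t * n)) * (2 * π))
    exact this)
  have hsum : ∀ θ : ℝ, ∑' k, f k θ = (Real.exp (HS S t) : ℂ) *
      ((∏ a ∈ S, phi1 t a θ) * Complex.exp (-(Complex.I * (n * θ)))) := by
    intro θ
    have h1 : ∑' k, f k θ = ∑' k, (pcnt S k : ℂ) * Complex.exp (-t + Complex.I * θ) ^ k *
      Complex.exp (-(Complex.I * (n * θ))) := by
      refine tsum_congr fun k => ?_
      rw [hpow]; rfl
    rw [h1, tsum_mul_right, (hev θ).2, ← mul_assoc (Real.exp (HS S t) : ℂ)]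
    congr 1
    rw [HS, Real.exp_sum, Complex.ofReal_prod, ← Finset.prod_mul_distrib]
    exact Finset.prod_congr rfl fun a ha => one_sub_inv_eq ht (hS a ha) θ
  simp_rw [hsum] at huniq
  rw [intervalIntegral.integral_const_mul] at huniq
  set J := ∫ θ in (-π)..π, (∏ a ∈ S, phi1 t a θ) * Complex.exp (-(Complex.I * (n * θ)))
  have hpi : (π : ℂ) ≠ 0 := by exact_mod_cast Real.pi_ne_zero
  have he : (Real.exp (n * t) : ℂ) * Real.exp (-(t * n)) = 1 := by
    rw [← Complex.ofReal_mul, ← Real.exp_add]; simp [mul_comm]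
  rw [Real.exp_add]
  push_cast at *
  field_simp
  linear_combination (-Complex.exp (n * t)) * huniq - (pcnt S n : ℂ) * 2 * π * he

/-- squared chord -/
noncomputable def chd (u : ℝ) : ℝ := 2 - 2 * Real.cos u

lemma chd_eq (u : ℝ) : chd u = 4 * Real.sin (u / 2) ^ 2 := by
  have := Real.cos_sq' (u / 2)
  have h2 := Real.cos_two_mul (u / 2)
  rw [show 2 * (u / 2) = u by ring] at h2
  rw [chd, h2, this]; ring

lemma chd_nonneg (u : ℝ) : 0 ≤ chd u := by rw [chd_eq]; positivity

lemma chd_le_four (u : ℝ) : chd u ≤ 4 := by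
  rw [chd]; linarith [Real.neg_one_le_cos u]

lemma chd_sub_le (u v : ℝ) : chd (u - v) ≤ 2 * (chd u + chd v) := by
  rw [chd_eq, chd_eq, chd_eq, sub_div, Real.sin_sub]
  have h1 := Real.sin_sq_add_cos_sq (u / 2)
  have h2 := Real.sin_sq_add_cos_sq (v / 2)
  set a := Real.sin (u / 2)
  set b := Real.cos (u / 2)
  set c := Real.sin (v / 2)
  set d := Real.cos (v / 2)
  have h3 : (a * d - b * c) ^ 2 ≤ 2 * ((a * d) ^ 2 + (b * c) ^ 2) := by
    nlinarith [sq_nonneg (a * d + b * c)]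
  have h4 : (a * d) ^ 2 ≤ a ^ 2 := by
    rw [mul_pow]; nlinarith [sq_nonneg a, sq_nonneg c]
  have h5 : (b * c) ^ 2 ≤ c ^ 2 := by
    rw [mul_pow]; nlinarith [sq_nonneg a, sq_nonneg c]
  nlinarith

lemma chd_lower {u : ℝ} (hu : |u| ≤ π) : 4 / π ^ 2 * u ^ 2 ≤ chd u := by
  have h := Real.mul_abs_le_abs_sin (x := u / 2) (by rw [abs_div, abs_two]; linarith)
  rw [chd_eq]
  have h2 : (2 / π * |u / 2|) ^ 2 ≤ |Real.sin (u / 2)| ^ 2 := by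
    apply pow_le_pow_left₀ (by positivity) h
  rw [mul_pow, sq_abs, sq_abs] at h2
  calc 4 / π ^ 2 * u ^ 2 = 4 * ((2 / π) ^ 2 * (u / 2) ^ 2) := by ring
    _ ≤ _ := by linarith

lemma mu_nonneg {t : ℝ} (ht : 0 < t) (a : ℕ) : 0 ≤ mu t a := by
  rw [mu, inv_nonneg, sub_nonneg]; exact Real.one_le_exp (by positivity)

lemma norm_phi1_inv_sq (t : ℝ) (a : ℕ) (θ : ℝ) :
    ‖(1 + (mu t a : ℂ) * (1 - Complex.exp (Complex.I * (a * θ : ℝ))))‖ ^ 2 =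
      1 + (mu t a + mu t a ^ 2) * chd (a * θ) := by
  rw [← Complex.normSq_eq_norm_sq, Complex.normSq_apply, mul_comm Complex.I, Complex.exp_mul_I,
    ← Complex.ofReal_cos, ← Complex.ofReal_sin, chd]
  have := Real.sin_sq_add_cos_sq (a * θ)
  set s := Real.sin (a * θ)
  set c := Real.cos (a * θ)
  simp
  linear_combination (mu t a) ^ 2 * this

lemma norm_phi1_le_one {t : ℝ} (ht : 0 < t) (a : ℕ) (θ : ℝ) : ‖phi1 t a θ‖ ≤ 1 := by
  rw [phi1, norm_inv]
  apply inv_le_one_of_one_le₀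
  have h := norm_phi1_inv_sq t a θ
  have := mu_nonneg ht a
  have := chd_nonneg (a * θ)
  rw [← one_le_sq_iff₀ (norm_nonneg _), h]
  have : 0 ≤ (mu t a + mu t a ^ 2) * chd (a * θ) := by positivity
  linarith

lemma norm_phi1_le {t κ : ℝ} (a : ℕ) (θ : ℝ) (h0 : 0 ≤ κ) (h4 : κ ≤ 1 / 4)
    (hκ : κ ≤ mu t a) : ‖phi1 t a θ‖ ≤ Real.exp (-(κ / 4 * chd (a * θ))) := by
  rw [phi1, norm_inv, Real.exp_neg]
  apply inv_anti₀ (Real.exp_pos _)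
  have h := norm_phi1_inv_sq t a θ
  have hs0 := chd_nonneg (a * θ)
  have hs4 := chd_le_four (a * θ)
  set s := chd (a * θ)
  rw [← pow_le_pow_iff_left₀ (Real.exp_pos _).le (norm_nonneg _) two_ne_zero, h,
    ← Real.exp_nat_mul]
  have hx0 : 0 ≤ κ * s := by positivity
  have hx1 : κ * s ≤ 1 := by nlinarith
  have e1 : Real.exp (κ * s / 2) * (1 - κ * s / 2) ≤ 1 := by
    have := Real.one_sub_le_exp_neg (κ * s / 2)
    have h2 := Real.exp_pos (κ * s / 2)
    calc _ ≤ Real.exp (κ * s / 2) * Real.exp (-(κ * s / 2)) := by gcongr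
      _ = 1 := by rw [← Real.exp_add]; simp
  have e2 : Real.exp (κ * s / 2) ≤ 1 + κ * s := by
    by_contra hcon
    push Not at hcon
    have : (1 + κ * s) * (1 - κ * s / 2) < Real.exp (κ * s / 2) * (1 - κ * s / 2) := by
      apply mul_lt_mul_of_pos_right hcon; linarith
    nlinarith
  have e3 : κ * s ≤ (mu t a + mu t a ^ 2) * s := by
    gcongr; nlinarith [sq_nonneg (mu t a)]
  calc Real.exp (((2 : ℕ) : ℝ) * (κ / 4 * s)) = Real.exp (κ * s / 2) := by congr 1; push_cast; ring
    _ ≤ _ := by linarith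

lemma bt_le {α : ℝ} (hα : 1 < α) (m : ℕ) : (bt α m : ℝ) ≤ α * m :=
  Nat.floor_le (by positivity)

lemma lt_bt {α : ℝ} (m : ℕ) : α * m - 1 < bt α m := Nat.sub_one_lt_floor _

lemma bt_lt {α : ℝ} (hα : 1 < α) {m k : ℕ} (h : m < k) : bt α m < bt α k := by
  have h1 := bt_le hα m
  have h2 := lt_bt (α := α) k
  have h3 : (m : ℝ) + 1 ≤ k := by exact_mod_cast h
  have : (bt α m : ℝ) < bt α k := by nlinarith
  exact_mod_cast this

lemma bt_strictMono {α : ℝ} (hα : 1 < α) : StrictMono (bt α) := fun _ _ h => bt_lt hα h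

lemma le_bt {α : ℝ} (hα : 1 < α) (m : ℕ) : m ≤ bt α m := (bt_strictMono hα).le_apply

lemma shift_sum_le (α θ : ℝ) {M r : ℕ} (hr : r ≤ M) :
    ∑ i ∈ Finset.range M, chd (((bt α (i + 1 + r) : ℝ) - bt α (i + 1)) * θ) ≤
      4 * ∑ i ∈ Finset.range (2 * M), chd (bt α (i + 1) * θ) := by
  have h1 : ∑ i ∈ Finset.range M, chd (bt α (i + 1) * θ) ≤
      ∑ i ∈ Finset.range (2 * M), chd (bt α (i + 1) * θ) := by
    apply Finset.sum_le_sum_of_subset_of_nonneg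
    · apply Finset.range_subset_range.mpr; omega
    · intros; apply chd_nonneg
  have h2 : ∑ i ∈ Finset.range M, chd (bt α (i + 1 + r) * θ) ≤
      ∑ i ∈ Finset.range (2 * M), chd (bt α (i + 1) * θ) := by
    have : ∑ i ∈ Finset.range M, chd (bt α (i + 1 + r) * θ) =
        ∑ i ∈ Finset.Ico r (r + M), chd (bt α (i + 1) * θ) := by
      rw [Finset.sum_Ico_eq_sum_range]
      rw [Nat.add_sub_cancel_left]
      refine Finset.sum_congr rfl fun i _ => ?_
      rw [show i + 1 + r = r + i + 1 by ring]
    rw [this]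
    apply Finset.sum_le_sum_of_subset_of_nonneg
    · intro x; simp only [Finset.mem_Ico, Finset.mem_range]; omega
    · intros; apply chd_nonneg
  calc _ ≤ ∑ i ∈ Finset.range M, 2 * (chd (bt α (i + 1 + r) * θ) + chd (bt α (i + 1) * θ)) := by
        refine Finset.sum_le_sum fun i _ => ?_
        rw [sub_mul]; exact chd_sub_le _ _
    _ = 2 * (∑ i ∈ Finset.range M, chd (bt α (i + 1 + r) * θ) +
          ∑ i ∈ Finset.range M, chd (bt α (i + 1) * θ)) := by
        rw [← Finset.mul_sum, Finset.sum_add_distrib]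
    _ ≤ _ := by linarith

lemma case_small {α : ℝ} (hα : 1 < α) {θ : ℝ} (hθ0 : θ ≠ 0) (hθ : |θ| ≤ π / (2 * α)) {M : ℕ}
    (hM : 1 ≤ M) :
    (α - 1) ^ 2 / (16 * α ^ 2) * min ((M : ℝ) ^ 3 * θ ^ 2) M ≤
      ∑ i ∈ Finset.range (2 * M), chd (bt α (i + 1) * θ) := by
  have hα0 : 0 < α := by linarith
  have hpos : 0 < |θ| := abs_pos.mpr hθ0
  set X := π / (2 * α * |θ|) with hX
  have hX1 : 1 ≤ X := by
    rw [hX, one_le_div (by positivity)]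
    rw [le_div_iff₀ (by positivity)] at hθ
    linarith
  set r := min M ⌊X⌋₊ with hr
  have hr1 : 1 ≤ r := le_min hM (Nat.le_floor (by exact_mod_cast hX1))
  have hrX : (r : ℝ) ≤ X := le_trans (by exact_mod_cast min_le_right _ _) (Nat.floor_le (by linarith))
  have hr1' : (1 : ℝ) ≤ r := by exact_mod_cast hr1
  have hterm : ∀ i, 4 / π ^ 2 * ((α - 1) ^ 2 * (r : ℝ) ^ 2 * θ ^ 2) ≤
      chd (((bt α (i + 1 + r) : ℝ) - bt α (i + 1)) * θ) := by
    intro i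
    have a1 := bt_le hα (i + 1 + r)
    have a2 := lt_bt (α := α) (i + 1 + r)
    have a3 := bt_le hα (i + 1)
    have a4 := lt_bt (α := α) (i + 1)
    push_cast at a1 a2 a3 a4
    set d := (bt α (i + 1 + r) : ℝ) - bt α (i + 1)
    have d1 : d ≤ α * r + 1 := by simp only [d]; nlinarith
    have d2 : α * r - 1 ≤ d := by simp only [d]; nlinarith
    have d3 : (α - 1) * r ≤ d := by nlinarith
    have d0 : 0 ≤ (α - 1) * r := by apply mul_nonneg <;> linarith
    have d4 : d ≤ 2 * α * r := by nlinarith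
    have hle : |d * θ| ≤ π := by
      rw [abs_mul, abs_of_nonneg (d0.trans d3)]
      calc d * |θ| ≤ 2 * α * X * |θ| := by gcongr; nlinarith
        _ = π := by rw [hX]; field_simp
    refine le_trans ?_ (chd_lower hle)
    have : ((α - 1) * r) ^ 2 ≤ d ^ 2 := by gcongr
    rw [mul_pow d]
    rw [mul_pow] at this
    gcongr
  have hsum := shift_sum_le α θ (min_le_left M ⌊X⌋₊)
  rw [← hr] at hsum
  have hs2 : (M : ℝ) * (4 / π ^ 2 * ((α - 1) ^ 2 * (r : ℝ) ^ 2 * θ ^ 2)) ≤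
      4 * ∑ i ∈ Finset.range (2 * M), chd (bt α (i + 1) * θ) := by
    refine le_trans ?_ hsum
    have := Finset.card_nsmul_le_sum (Finset.range M)
      (fun i => chd (((bt α (i + 1 + r) : ℝ) - bt α (i + 1)) * θ)) _ (fun i _ => hterm i)
    simpa using this
  set T := ∑ i ∈ Finset.range (2 * M), chd (bt α (i + 1) * θ)
  rcases min_cases M ⌊X⌋₊ with ⟨h, _⟩ | ⟨h, _⟩
  · rw [← hr] at h
    rw [h] at hs2
    have hc : (α - 1) ^ 2 / (16 * α ^ 2) ≤ (α - 1) ^ 2 / π ^ 2 := by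
      gcongr
      have := Real.pi_lt_four
      nlinarith [Real.pi_pos]
    calc (α - 1) ^ 2 / (16 * α ^ 2) * min ((M : ℝ) ^ 3 * θ ^ 2) M
        ≤ (α - 1) ^ 2 / π ^ 2 * ((M : ℝ) ^ 3 * θ ^ 2) := by gcongr; exact min_le_left _ _
      _ = (M : ℝ) * (4 / π ^ 2 * ((α - 1) ^ 2 * (M : ℝ) ^ 2 * θ ^ 2)) / 4 := by ring
      _ ≤ T := by linarith
  · rw [← hr] at h
    have hrl : X / 2 ≤ r := by
      rw [h]
      have := Nat.sub_one_lt_floor X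
      by_cases hX2 : X ≤ 2
      · have : (1 : ℝ) ≤ ⌊X⌋₊ := by exact_mod_cast Nat.le_floor (by exact_mod_cast hX1)
        linarith
      · push Not at hX2; linarith
    have hrθ : π ^ 2 / (16 * α ^ 2) ≤ (r : ℝ) ^ 2 * θ ^ 2 := by
      have : (X / 2) ^ 2 ≤ (r : ℝ) ^ 2 := by gcongr
      calc π ^ 2 / (16 * α ^ 2) = (X / 2) ^ 2 * |θ| ^ 2 := by rw [hX]; field_simp; ring
        _ ≤ (r : ℝ) ^ 2 * |θ| ^ 2 := by gcongr
        _ = _ := by rw [sq_abs]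
    calc (α - 1) ^ 2 / (16 * α ^ 2) * min ((M : ℝ) ^ 3 * θ ^ 2) M
        ≤ (α - 1) ^ 2 / (16 * α ^ 2) * M := by gcongr; exact min_le_right _ _
      _ = (M : ℝ) * (4 / π ^ 2 * ((α - 1) ^ 2 * (π ^ 2 / (16 * α ^ 2)))) / 4 := by field_simp
      _ ≤ (M : ℝ) * (4 / π ^ 2 * ((α - 1) ^ 2 * ((r : ℝ) ^ 2 * θ ^ 2))) / 4 := by gcongr
      _ ≤ T := by rw [← mul_assoc ((α - 1) ^ 2)]; linarith

lemma case_large {α : ℝ} (hα : 1 < α) (hirr : Irrational α) :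
    ∃ η > 0, ∃ M₀ : ℕ, ∀ M ≥ M₀, ∀ θ : ℝ, π / (2 * α) ≤ |θ| → |θ| ≤ π →
    η * M ≤ ∑ i ∈ Finset.range (2 * M), chd (bt α (i + 1) * θ) := by
  have hα0 : 0 < α := by linarith
  set k : ℕ := ⌊α⌋₊ with hk
  have hk1 : (k : ℝ) < α := lt_of_le_of_ne (Nat.floor_le hα0.le) (by
    intro h; exact hirr ⟨k, by simpa using h⟩)
  have hk2 : α < k + 1 := Nat.lt_floor_add_one α
  set η := min (k + 1 - α) (α - k) with hη
  have hη0 : 0 < η := lt_min (by linarith) (by linarith)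
  have hη1 : η ≤ k + 1 - α := min_le_left _ _
  have hη2 : η ≤ α - k := min_le_right _ _
  refine ⟨η / (16 * α ^ 2), by positivity, max 1 ⌈2 / η⌉₊, fun M hM θ hθ1 hθ2 => ?_⟩
  have hM1 : 1 ≤ M := le_trans (le_max_left _ _) hM
  have hM2 : 2 / η ≤ M := (Nat.le_ceil _).trans (by exact_mod_cast le_trans (le_max_right _ _) hM)
  have hMη : 2 ≤ η * M := by rw [div_le_iff₀ hη0] at hM2; linarith
  have hsum := shift_sum_le α θ hM1
  have hd : ∀ i, chd (((bt α (i + 1 + 1) : ℝ) - bt α (i + 1)) * θ) =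
      ((k + 1 : ℝ) - ((bt α (i + 1 + 1) : ℝ) - bt α (i + 1))) * chd (k * θ) +
      (((bt α (i + 1 + 1) : ℝ) - bt α (i + 1)) - k) * chd ((k + 1) * θ) := by
    intro i
    have a1 := bt_le hα (i + 1 + 1)
    have a2 := lt_bt (α := α) (i + 1 + 1)
    have a3 := bt_le hα (i + 1)
    have a4 := lt_bt (α := α) (i + 1)
    push_cast at a1 a2 a3 a4
    have b1 : bt α (i + 1) + k < bt α (i + 1 + 1) + 1 := by
      have : (bt α (i + 1) : ℝ) + k < bt α (i + 1 + 1) + 1 := by linarith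
      exact_mod_cast this
    have b2 : bt α (i + 1 + 1) < bt α (i + 1) + k + 2 := by
      have : (bt α (i + 1 + 1) : ℝ) < bt α (i + 1) + k + 2 := by linarith
      exact_mod_cast this
    have : bt α (i + 1 + 1) = bt α (i + 1) + k ∨ bt α (i + 1 + 1) = bt α (i + 1) + k + 1 := by omega
    rcases this with h | h
    · rw [h]; push_cast
      rw [show (bt α (i + 1) : ℝ) + k - bt α (i + 1) = k by ring]; ring
    · rw [h]; push_cast
      rw [show (bt α (i + 1) : ℝ) + k + 1 - bt α (i + 1) = k + 1 by ring]; ring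
  simp_rw [hd] at hsum
  have tele := Finset.sum_range_sub (fun i => (bt α (i + 1) : ℝ)) M
  have s1 : ∑ i ∈ Finset.range M, ((k + 1 : ℝ) - ((bt α (i + 1 + 1) : ℝ) - bt α (i + 1))) =
      M * (k + 1) - ((bt α (M + 1) : ℝ) - bt α (0 + 1)) := by
    rw [Finset.sum_sub_distrib, tele]; simp; ring
  have s2 : ∑ i ∈ Finset.range M, (((bt α (i + 1 + 1) : ℝ) - bt α (i + 1)) - k) =
      ((bt α (M + 1) : ℝ) - bt α (0 + 1)) - M * k := by
    rw [Finset.sum_sub_distrib, tele]; simp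
  rw [Finset.sum_add_distrib, ← Finset.sum_mul, ← Finset.sum_mul, s1, s2] at hsum
  have a1 := bt_le hα (M + 1)
  have a2 := lt_bt (α := α) (M + 1)
  have a3 := bt_le hα (0 + 1)
  have a4 := lt_bt (α := α) (0 + 1)
  push_cast at a1 a2 a3 a4
  set D := (bt α (M + 1) : ℝ) - bt α (0 + 1) with hD
  set T := ∑ i ∈ Finset.range (2 * M), chd (bt α (i + 1) * θ)
  have hc1 : η * M / 2 ≤ M * ((k : ℝ) + 1) - D := by nlinarith
  have hc2 : η * M / 2 ≤ D - M * (k : ℝ) := by nlinarith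
  have hθs : 1 / α ^ 2 ≤ chd θ := by
    refine le_trans ?_ (chd_lower hθ2)
    have : (π / (2 * α)) ^ 2 ≤ |θ| ^ 2 := by gcongr
    rw [sq_abs] at this
    calc 1 / α ^ 2 = 4 / π ^ 2 * (π / (2 * α)) ^ 2 := by field_simp; norm_num
      _ ≤ _ := by gcongr
  have htri := chd_sub_le ((k + 1) * θ) (k * θ)
  rw [show ((k : ℝ) + 1) * θ - k * θ = θ by ring] at htri
  have n1 := chd_nonneg (k * θ)
  have n2 := chd_nonneg ((k + 1) * θ)
  have e1 : η * M / 2 * chd (k * θ) + η * M / 2 * chd ((k + 1) * θ) ≤ 4 * T := by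
    refine le_trans ?_ hsum
    gcongr
  have e2 : η * M / 4 * (1 / α ^ 2) ≤ 4 * T := by
    calc η * M / 4 * (1 / α ^ 2) ≤ η * M / 4 * (2 * (chd ((k + 1) * θ) + chd (k * θ))) := by
          gcongr; linarith
      _ ≤ 4 * T := by linarith
  calc η / (16 * α ^ 2) * M = (η * M / 4 * (1 / α ^ 2)) / 4 := by field_simp; ring
    _ ≤ T := by linarith

lemma expsum_lower {α : ℝ} (hα : 1 < α) (hirr : Irrational α) :
    ∃ c > 0, ∃ M₀ : ℕ, ∀ M ≥ M₀, ∀ θ : ℝ, |θ| ≤ π →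
    c * min ((M : ℝ) ^ 3 * θ ^ 2) M ≤ ∑ i ∈ Finset.range (2 * M), chd (bt α (i + 1) * θ) := by
  obtain ⟨η, hη, M₀, H⟩ := case_large hα hirr
  have hα1 : 0 < α - 1 := by linarith
  refine ⟨min η ((α - 1) ^ 2 / (16 * α ^ 2)), lt_min hη (by positivity), max 1 M₀,
    fun M hM θ hθ => ?_⟩
  have hM1 : 1 ≤ M := le_trans (le_max_left _ _) hM
  have hmin : 0 ≤ min ((M : ℝ) ^ 3 * θ ^ 2) M := le_min (by positivity) (by positivity)
  by_cases h0 : θ = 0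
  · subst h0; simp [chd]
  · rcases le_total |θ| (π / (2 * α)) with h | h
    · refine le_trans ?_ (case_small hα h0 h hM1)
      gcongr; exact min_le_right _ _
    · refine le_trans ?_ (H M (le_trans (le_max_right _ _) hM) θ h hθ)
      gcongr
      · exact min_le_left _ _
      · exact min_le_right _ _

lemma bset_pos {α : ℝ} {n a : ℕ} (ha : a ∈ bset α n) : 0 < a := (mem_bset.mp ha).1.1

lemma phi_prod_bound {α : ℝ} (hα : 1 < α) (hirr : Irrational α) :
    ∃ c > 0, ∃ t₀ > 0, t₀ ≤ 1 ∧ ∀ t : ℝ, 0 < t → t ≤ t₀ → ∀ n : ℕ, 2 * α / t ≤ n →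
      ∀ θ : ℝ, |θ| ≤ π →
      ‖∏ a ∈ bset α n, phi1 t a θ‖ ≤ Real.exp (-(c * min (θ ^ 2 / t ^ 3) (1 / t))) := by
  obtain ⟨c, hc, M₀, H⟩ := expsum_lower hα hirr
  have hα0 : 0 < α := by linarith
  set κ := min (1 / 4) (Real.exp (-(2 * α))) with hκ
  have hκ0 : 0 < κ := lt_min (by norm_num) (Real.exp_pos _)
  refine ⟨κ / 4 * (c / 8), by positivity, 1 / (M₀ + 2), by positivity, ?_, ?_⟩
  · rw [div_le_one (by positivity)]; have : (0 : ℝ) ≤ M₀ := by positivity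
    linarith
  intro t ht ht0 n hn θ hθ
  set M := ⌊1 / t⌋₊ with hM
  have h1t : (M₀ : ℝ) + 2 ≤ 1 / t := by
    rw [le_div_iff₀ ht]; rw [le_div_iff₀ (by positivity)] at ht0; linarith
  have hMM₀ : M₀ ≤ M := Nat.le_floor (by linarith)
  have hMle : (M : ℝ) ≤ 1 / t := Nat.floor_le (by positivity)
  have hMge : 1 / (2 * t) ≤ M := by
    have h := Nat.sub_one_lt_floor (1 / t)
    have h2 : (0 : ℝ) ≤ M₀ := by positivity
    have : 1 / (2 * t) = (1 / t) / 2 := by field_simp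
    rw [this]; linarith
  have hb : ∀ i ∈ Finset.range (2 * M), (bt α (i + 1) : ℝ) ≤ 2 * α / t := by
    intro i hi
    have h1 := bt_le hα (i + 1)
    have h2 : ((i + 1 : ℕ) : ℝ) ≤ 2 * M := by
      have := Finset.mem_range.mp hi; exact_mod_cast this
    calc (bt α (i + 1) : ℝ) ≤ α * (2 * M) := h1.trans (by gcongr)
      _ ≤ α * (2 * (1 / t)) := by gcongr
      _ = _ := by ring
  set T := (Finset.range (2 * M)).image (fun i => bt α (i + 1)) with hT
  have hTS : T ⊆ bset α n := by
    intro a ha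
    obtain ⟨i, hi, rfl⟩ := Finset.mem_image.mp ha
    rw [mem_bset]
    refine ⟨⟨le_trans (by omega) (le_bt hα (i + 1)), ?_⟩, i + 1, by omega, rfl⟩
    have := (hb i hi).trans hn
    exact_mod_cast this
  rw [norm_prod, ← Finset.prod_sdiff hTS]
  have p1 : ∏ a ∈ bset α n \ T, ‖phi1 t a θ‖ ≤ 1 :=
    Finset.prod_le_one (fun _ _ => norm_nonneg _) (fun a _ => norm_phi1_le_one ht a θ)
  have p2 : ∏ a ∈ T, ‖phi1 t a θ‖ ≤
      Real.exp (-(κ / 4 * ∑ i ∈ Finset.range (2 * M), chd (bt α (i + 1) * θ))) := by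
    rw [hT, Finset.prod_image (by
      intro i _ j _ hij; have := (bt_strictMono hα).injective hij; omega)]
    rw [Finset.mul_sum, ← Finset.sum_neg_distrib, Real.exp_sum]
    apply Finset.prod_le_prod (fun _ _ => norm_nonneg _)
    intro i hi
    apply norm_phi1_le _ _ hκ0.le (min_le_left _ _)
    have hpos : 0 < t * (bt α (i + 1) : ℝ) := by
      have : 0 < bt α (i + 1) := lt_of_lt_of_le (by omega) (le_bt hα (i + 1))
      positivity
    have hle : t * (bt α (i + 1) : ℝ) ≤ 2 * α := by
      have := hb i hi
      rw [le_div_iff₀ ht] at this; linarith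
    refine (min_le_right _ _).trans ?_
    rw [mu, Real.exp_neg]
    apply inv_anti₀
    · have := Real.add_one_lt_exp hpos.ne'; linarith
    · have := Real.exp_le_exp.mpr hle; linarith
  calc _ ≤ 1 * Real.exp (-(κ / 4 * ∑ i ∈ Finset.range (2 * M), chd (bt α (i + 1) * θ))) := by
        gcongr
    _ ≤ _ := by
        rw [one_mul]
        apply Real.exp_le_exp.mpr
        apply neg_le_neg
        rw [mul_assoc]
        gcongr
        refine le_trans ?_ (H M hMM₀ θ hθ)
        rw [div_mul_eq_mul_div, mul_div_assoc]
        gcongr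
        apply le_min
        · calc min (θ ^ 2 / t ^ 3) (1 / t) / 8 ≤ (θ ^ 2 / t ^ 3) / 8 := by gcongr; exact min_le_left _ _
            _ = (1 / (2 * t)) ^ 3 * θ ^ 2 := by field_simp; norm_num
            _ ≤ _ := by gcongr
        · calc min (θ ^ 2 / t ^ 3) (1 / t) / 8 ≤ (1 / t) / 8 := by gcongr; exact min_le_right _ _
            _ ≤ 1 / (2 * t) := by rw [div_div]; apply one_div_le_one_div_of_le <;> linarith
            _ ≤ M := hMge

lemma phi1_continuous {t : ℝ} (ht : 0 < t) (a : ℕ) : Continuous (fun θ : ℝ => phi1 t a θ) := by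
  unfold phi1
  apply Continuous.inv₀
  · fun_prop
  · intro θ h
    have h1 := norm_phi1_inv_sq t a θ
    rw [h] at h1
    have := mu_nonneg ht a
    have := chd_nonneg (a * θ)
    have : 0 ≤ (mu t a + mu t a ^ 2) * chd (a * θ) := by positivity
    simp at h1
    linarith

lemma integrand_continuous {t : ℝ} (ht : 0 < t) (S : Finset ℕ) (n : ℕ) :
    Continuous (fun θ : ℝ => (∏ a ∈ S, phi1 t a θ) * Complex.exp (-(Complex.I * (n * θ)))) := by
  apply Continuous.mul
  · exact continuous_finsetProd _ fun a _ => phi1_continuous ht a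
  · fun_prop

lemma norm_integrand (t : ℝ) (S : Finset ℕ) (n : ℕ) (θ : ℝ) :
    ‖(∏ a ∈ S, phi1 t a θ) * Complex.exp (-(Complex.I * (n * θ)))‖ = ‖∏ a ∈ S, phi1 t a θ‖ := by
  rw [norm_mul, Complex.norm_exp]; simp

lemma pcnt_upper {α : ℝ} (hα : 1 < α) (hirr : Irrational α) :
    ∃ C > 0, ∃ t₀ > 0, ∀ t : ℝ, 0 < t → t ≤ t₀ → ∀ n : ℕ, 2 * α / t ≤ n →
      (pcnt (bset α n) n : ℝ) ≤ C * Real.exp (HS (bset α n) t + n * t) * (t * √t) := by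
  obtain ⟨c, hc, t₀, ht₀, ht₁, H⟩ := phi_prod_bound hα hirr
  refine ⟨(√(π / c) + 2 * π * (2 / c ^ 2)) / (2 * π), by positivity, t₀, ht₀, fun t ht htt n hn => ?_⟩
  have hF := pcnt_fourier (S := bset α n) (fun a ha => bset_pos ha) n ht
  have hn1 : (pcnt (bset α n) n : ℝ) = ‖(pcnt (bset α n) n : ℂ)‖ := by simp
  rw [hn1, hF, norm_mul, Complex.norm_real, Real.norm_of_nonneg (by positivity)]
  set J := ∫ θ in (-π)..π, (∏ a ∈ bset α n, phi1 t a θ) * Complex.exp (-(Complex.I * (n * θ)))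
  have hJ : ‖J‖ ≤ (√(π / c) + 2 * π * (2 / c ^ 2)) * (t * √t) := by
    have hpi := Real.pi_pos
    have hbd : ‖J‖ ≤ ∫ θ in (-π)..π, (Real.exp (-(c / t ^ 3) * θ ^ 2) + Real.exp (-(c / t))) := by
      apply intervalIntegral.norm_integral_le_of_norm_le (by linarith)
      · refine Filter.Eventually.of_forall fun θ hθ => ?_
        rw [norm_integrand]
        refine (H t ht htt n hn θ (abs_le.mpr ⟨hθ.1.le, hθ.2⟩)).trans ?_
        rcases min_cases (θ ^ 2 / t ^ 3) (1 / t) with ⟨h, _⟩ | ⟨h, _⟩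
        · rw [h, show -(c * (θ ^ 2 / t ^ 3)) = -(c / t ^ 3) * θ ^ 2 by ring]
          linarith [Real.exp_pos (-(c / t))]
        · rw [h, show -(c * (1 / t)) = -(c / t) by ring]
          linarith [Real.exp_pos (-(c / t ^ 3) * θ ^ 2)]
      · apply Continuous.intervalIntegrable; fun_prop
    have hct : 0 < c / t ^ 3 := by positivity
    rw [intervalIntegral.integral_add (by apply Continuous.intervalIntegrable; fun_prop)
      (by simp)] at hbd
    have hg : ∫ θ in (-π)..π, Real.exp (-(c / t ^ 3) * θ ^ 2) ≤ √(π / c) * (t * √t) := by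
      rw [intervalIntegral.integral_of_le (by linarith)]
      calc _ ≤ ∫ θ : ℝ, Real.exp (-(c / t ^ 3) * θ ^ 2) := by
            apply MeasureTheory.setIntegral_le_integral (integrable_exp_neg_mul_sq hct)
            exact Filter.Eventually.of_forall fun x => (Real.exp_pos _).le
        _ = √(π / (c / t ^ 3)) := integral_gaussian _
        _ = √(π / c) * (t * √t) := by
            rw [show π / (c / t ^ 3) = (π / c) * (t ^ 2 * t) by field_simp,
              Real.sqrt_mul (by positivity), Real.sqrt_mul (by positivity), Real.sqrt_sq ht.le]
    have he : Real.exp (-(c / t)) ≤ 2 / c ^ 2 * (t * √t) := by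
      have h1 : (c / t) ^ 2 / 2 ≤ Real.exp (c / t) := by
        have := Real.quadratic_le_exp_of_nonneg (x := c / t) (by positivity)
        have : 0 < c / t := by positivity
        linarith
      rw [Real.exp_neg]
      calc (Real.exp (c / t))⁻¹ ≤ ((c / t) ^ 2 / 2)⁻¹ := inv_anti₀ (by positivity) h1
        _ = 2 / c ^ 2 * (t * t) := by field_simp
        _ ≤ 2 / c ^ 2 * (t * √t) := by
            gcongr
            apply Real.le_sqrt_of_sq_le; nlinarith
    simp only [intervalIntegral.integral_const, smul_eq_mul] at hbd
    calc ‖J‖ ≤ √(π / c) * (t * √t) + (π - -π) * (2 / c ^ 2 * (t * √t)) := by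
          refine hbd.trans ?_
          gcongr
          linarith
      _ = _ := by ring
  calc _ ≤ Real.exp (HS (bset α n) t + n * t) / (2 * π) *
        ((√(π / c) + 2 * π * (2 / c ^ 2)) * (t * √t)) := by gcongr
    _ = _ := by ring

lemma bose_le {x : ℝ} (hx : 0 < x) : (Real.exp x - 1)⁻¹ * x ≤ Real.exp (-(x / 4)) ^ 2 := by
  have h1 : 0 < Real.exp x - 1 := by have := Real.add_one_lt_exp hx.ne'; linarith
  have h2 := Real.self_le_sinh_iff.mpr (show 0 ≤ x / 2 by linarith)
  rw [Real.sinh_eq] at h2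
  rw [inv_mul_le_iff₀ h1]
  have h3 : Real.exp (-(x / 4)) ^ 2 = Real.exp (-(x / 2)) := by
    rw [← Real.exp_nat_mul]; congr 1; push_cast; ring
  have h4 : Real.exp (x / 2) * Real.exp (-(x / 2)) = 1 := by rw [← Real.exp_add]; simp
  have h5 : Real.exp x = Real.exp (x / 2) * Real.exp (x / 2) := by rw [← Real.exp_add]; ring_nf
  rw [h3, h5]
  set p := Real.exp (x / 2)
  set q := Real.exp (-(x / 2))
  have : (p * p - 1) * q = p - q := by linear_combination p * h4
  rw [this]; linarith

lemma x_exp_le {x : ℝ} (hx : 0 < x) : x * Real.exp (-(x / 4)) ≤ 4 := by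
  have h := Real.add_one_le_exp (x / 4)
  have h4 : Real.exp (x / 4) * Real.exp (-(x / 4)) = 1 := by rw [← Real.exp_add]; simp
  have := Real.exp_pos (-(x / 4))
  nlinarith

lemma x2_exp_le {x : ℝ} (hx : 0 < x) : x ^ 2 * Real.exp (-(x / 4)) ≤ 32 := by
  have h := Real.quadratic_le_exp_of_nonneg (x := x / 4) (by positivity)
  have h4 : Real.exp (x / 4) * Real.exp (-(x / 4)) = 1 := by rw [← Real.exp_add]; simp
  have := Real.exp_pos (-(x / 4))
  have h5 : x ^ 2 ≤ 32 * Real.exp (x / 4) := by nlinarith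
  calc _ ≤ 32 * Real.exp (x / 4) * Real.exp (-(x / 4)) := by gcongr
    _ = 32 := by rw [mul_assoc, h4, mul_one]

lemma exp_I_taylor (u : ℝ) :
    ‖(1 - Complex.exp (Complex.I * u)) - (-(Complex.I * u) + u ^ 2 / 2)‖ ≤ 4 * |u| ^ 3 := by
  have hnu : ‖Complex.I * (u : ℂ)‖ = |u| := by simp
  rcases le_or_gt |u| 1 with h | h
  · have hb := Complex.exp_bound (x := Complex.I * u) (by rw [hnu]; exact h) (n := 3) (by norm_num)
    rw [hnu] at hb
    have e : (1 - Complex.exp (Complex.I * u)) - (-(Complex.I * u) + u ^ 2 / 2) =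
        -(Complex.exp (Complex.I * u) - ∑ m ∈ Finset.range 3, (Complex.I * u) ^ m / m.factorial) := by
      simp [Finset.sum_range_succ, Nat.factorial, mul_pow]
      ring
    rw [e, norm_neg]
    refine hb.trans ?_
    rw [mul_comm]
    gcongr
    norm_num [Nat.factorial]
  · have h1 : ‖Complex.exp (Complex.I * u)‖ = 1 := by rw [Complex.norm_exp]; simp
    have h2 : ‖(u : ℂ) ^ 2 / 2‖ = |u| ^ 2 / 2 := by simp
    calc _ ≤ (‖(1 : ℂ)‖ + ‖Complex.exp (Complex.I * u)‖) + (‖-(Complex.I * (u : ℂ))‖ + ‖(u : ℂ) ^ 2 / 2‖) :=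
          (norm_sub_le _ _).trans (add_le_add (norm_sub_le _ _) (norm_add_le _ _))
      _ = 2 + |u| + |u| ^ 2 / 2 := by rw [norm_neg, hnu, h1, h2, norm_one]; ring
      _ ≤ 4 * |u| ^ 3 := by
          have a1 : |u| ≤ |u| ^ 2 := by nlinarith
          have a2 : |u| ^ 2 ≤ |u| ^ 3 := by nlinarith [sq_nonneg |u|]
          nlinarith

/-- exponent of the Gaussian approximation (negated) -/
noncomputable def zz (t : ℝ) (a : ℕ) (θ : ℝ) : ℂ :=
  -(Complex.I * ((mu t a * (a * θ) : ℝ) : ℂ)) + (((mu t a + mu t a ^ 2) * (a * θ) ^ 2 / 2 : ℝ) : ℂ)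

lemma norm_exp_neg_zz {t : ℝ} (ht : 0 < t) (a : ℕ) (θ : ℝ) : ‖Complex.exp (-zz t a θ)‖ ≤ 1 := by
  rw [Complex.norm_exp]
  have := mu_nonneg ht a
  have h : (-zz t a θ).re = -((mu t a + mu t a ^ 2) * (a * θ) ^ 2 / 2) := by
    simp only [zz, Complex.neg_re, Complex.add_re, Complex.mul_re, Complex.I_re, Complex.I_im,
      Complex.ofReal_re, Complex.ofReal_im]
    ring
  rw [h, Real.exp_le_one_iff]
  have : 0 ≤ (mu t a + mu t a ^ 2) * (a * θ) ^ 2 / 2 := by positivity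
  linarith

lemma var_le {t : ℝ} (ht : 0 < t) {a : ℕ} (ha : 0 < a) :
    (mu t a + mu t a ^ 2) * (a : ℝ) ^ 2 ≤ 5 * Real.exp (-(t * a / 4)) / t ^ 2 := by
  have hx : 0 < t * a := by positivity
  have b1 := bose_le hx
  have b2 := x_exp_le hx
  have hm := mu_nonneg ht a
  change mu t a * (t * a) ≤ _ at b1
  set E := Real.exp (-(t * a / 4)) with hE
  have hE0 : 0 < E := Real.exp_pos _
  have hE1 : E ≤ 1 := Real.exp_le_one_iff.mpr (by linarith)
  set x := t * a with hxd
  set μ := mu t a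
  rw [le_div_iff₀ (by positivity)]
  have e : (μ + μ ^ 2) * (a : ℝ) ^ 2 * t ^ 2 = μ * x * x + (μ * x) ^ 2 := by rw [hxd]; ring
  rw [e]
  have h1 : μ * x * x ≤ 4 * E := by
    calc μ * x * x ≤ E ^ 2 * x := by gcongr
      _ = E * (x * E) := by ring
      _ ≤ E * 4 := by gcongr
      _ = 4 * E := by ring
  have h2 : μ * x ≤ E := by nlinarith
  have h3 : (μ * x) ^ 2 ≤ E := by
    calc (μ * x) ^ 2 ≤ E ^ 2 := by gcongr
      _ ≤ E := by nlinarith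
  linarith

set_option maxHeartbeats 2000000 in
lemma phi1_approx {t : ℝ} (ht : 0 < t) {a : ℕ} (ha : 0 < a) {θ : ℝ} (hθ : |θ| / t ≤ 1 / 4) :
    ‖phi1 t a θ - Complex.exp (-zz t a θ)‖ ≤ 140 * Real.exp (-(t * a / 4)) * (|θ| / t) ^ 3 := by
  have hx : 0 < t * a := by positivity
  have b1 := bose_le hx
  have b2 := x_exp_le hx
  have b3 := x2_exp_le hx
  have hm := mu_nonneg ht a
  have hvar := var_le ht ha
  change mu t a * (t * a) ≤ _ at b1
  set E := Real.exp (-(t * a / 4)) with hE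
  have hE0 : 0 < E := Real.exp_pos _
  have hE1 : E ≤ 1 := Real.exp_le_one_iff.mpr (by linarith)
  set v := |θ| / t with hv
  have hv0 : 0 ≤ v := by positivity
  have hθv : |θ| = t * v := by rw [hv]; field_simp
  set x := t * a with hxd
  have hu : |(a : ℝ) * θ| = x * v := by rw [abs_mul, hθv, Nat.abs_cast, hxd]; ring
  -- bounds
  have hμu : mu t a * |(a : ℝ) * θ| ≤ E * v := by
    rw [hu, ← mul_assoc]
    have : mu t a * x ≤ E := by nlinarith
    gcongr
  have hq : (mu t a + mu t a ^ 2) * ((a : ℝ) * θ) ^ 2 / 2 ≤ 5 / 2 * E * v ^ 2 := by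
    calc (mu t a + mu t a ^ 2) * ((a : ℝ) * θ) ^ 2 / 2
        = (mu t a + mu t a ^ 2) * (a : ℝ) ^ 2 * |θ| ^ 2 / 2 := by rw [sq_abs]; ring
      _ ≤ 5 * E / t ^ 2 * |θ| ^ 2 / 2 := by gcongr
      _ = 5 / 2 * E * v ^ 2 := by rw [hv]; ring
  have hμu3 : mu t a * |(a : ℝ) * θ| ^ 3 ≤ 32 * E * v ^ 3 := by
    calc mu t a * |(a : ℝ) * θ| ^ 3 = (mu t a * x) * x ^ 2 * v ^ 3 := by rw [hu]; ring
      _ ≤ E ^ 2 * x ^ 2 * v ^ 3 := by gcongr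
      _ = E * (x ^ 2 * E) * v ^ 3 := by ring
      _ ≤ E * 32 * v ^ 3 := by gcongr
      _ = _ := by ring
  have htay := exp_I_taylor (a * θ)
  set u := (a : ℝ) * θ
  set μ := mu t a
  set p := μ * u with hp
  set q := (μ + μ ^ 2) * u ^ 2 / 2 with hqd
  have hq0 : 0 ≤ q := by positivity
  have hpn : |p| ≤ E * v := by rw [hp, abs_mul, abs_of_nonneg hm]; exact hμu
  have hz : zz t a θ = -(Complex.I * (p : ℂ)) + (q : ℂ) := rfl
  set z := zz t a θ
  have hzn : ‖z‖ ≤ 2 * (E * v) := by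
    rw [hz]
    calc _ ≤ ‖-(Complex.I * (p : ℂ))‖ + ‖(q : ℂ)‖ := norm_add_le _ _
      _ = |p| + q := by simp [abs_of_nonneg hq0]
      _ ≤ E * v + 5 / 2 * E * v ^ 2 := by linarith
      _ ≤ 2 * (E * v) := by
        have : E * v * v ≤ E * v * (1 / 4) := by gcongr
        nlinarith [mul_nonneg hE0.le hv0]
  have hz1 : ‖z‖ ≤ 1 := by nlinarith
  -- inverse of phi
  set P : ℂ := 1 + (μ : ℂ) * (1 - Complex.exp (Complex.I * u)) with hP
  have hP1 : ‖P - (1 + (μ : ℂ) * (-(Complex.I * u) + u ^ 2 / 2))‖ ≤ 128 * E * v ^ 3 := by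
    rw [hP, add_sub_add_left_eq_sub, ← mul_sub, norm_mul, Complex.norm_real, Real.norm_of_nonneg hm]
    calc _ ≤ μ * (4 * |u| ^ 3) := by gcongr
      _ ≤ _ := by linarith
  have hexp : ‖Complex.exp z - (1 + z + z ^ 2 / 2)‖ ≤ 8 * E * v ^ 3 := by
    have hb := Complex.exp_bound hz1 (n := 3) (by norm_num)
    have e : ∑ m ∈ Finset.range 3, z ^ m / m.factorial = 1 + z + z ^ 2 / 2 := by
      simp [Finset.sum_range_succ, Nat.factorial]
    rw [e] at hb
    calc _ ≤ ‖z‖ ^ 3 * 1 := by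
          refine hb.trans ?_
          gcongr
          norm_num [Nat.factorial]
      _ ≤ (2 * (E * v)) ^ 3 * 1 := by gcongr
      _ = 8 * E * v ^ 3 * (E ^ 2) := by ring
      _ ≤ 8 * E * v ^ 3 * 1 := by gcongr; nlinarith
      _ = _ := by ring
  have hmid : ‖(1 + z + z ^ 2 / 2) - (1 + (μ : ℂ) * (-(Complex.I * u) + u ^ 2 / 2))‖ ≤
      4 * E * v ^ 3 := by
    have e : (1 + z + z ^ 2 / 2) - (1 + (μ : ℂ) * (-(Complex.I * u) + u ^ 2 / 2)) =
        -(Complex.I * (p * q : ℝ)) + (q ^ 2 / 2 : ℝ) := by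
      rw [hz, hp, hqd]
      push_cast
      linear_combination (μ : ℂ) ^ 2 * u ^ 2 / 2 * Complex.I_sq
    rw [e]
    have hEv : E * E ≤ E := by nlinarith
    calc _ ≤ ‖-(Complex.I * ((p * q : ℝ) : ℂ))‖ + ‖((q ^ 2 / 2 : ℝ) : ℂ)‖ := norm_add_le _ _
      _ = |p| * q + q ^ 2 / 2 := by
          rw [norm_neg, norm_mul, Complex.norm_I, Complex.norm_real, Complex.norm_real, one_mul,
            Real.norm_eq_abs, abs_mul, abs_of_nonneg hq0, Real.norm_of_nonneg (by positivity)]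
      _ ≤ (E * v) * (5 / 2 * E * v ^ 2) + (5 / 2 * E * v ^ 2) ^ 2 / 2 := by gcongr
      _ = (E * E) * (5 / 2 * v ^ 3 + 25 / 8 * v ^ 3 * v) := by ring
      _ ≤ E * (5 / 2 * v ^ 3 + 25 / 8 * v ^ 3 * (1 / 4)) := by gcongr
      _ ≤ 4 * E * v ^ 3 := by nlinarith [mul_nonneg hE0.le (pow_nonneg hv0 3)]
  have htot : ‖Complex.exp z - P‖ ≤ 140 * E * v ^ 3 := by
    have e : Complex.exp z - P = (Complex.exp z - (1 + z + z ^ 2 / 2)) +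
      ((1 + z + z ^ 2 / 2) - (1 + (μ : ℂ) * (-(Complex.I * u) + u ^ 2 / 2))) -
      (P - (1 + (μ : ℂ) * (-(Complex.I * u) + u ^ 2 / 2))) := by ring
    rw [e]
    refine (norm_sub_le _ _).trans ((add_le_add (norm_add_le _ _) le_rfl).trans ?_)
    linarith
  have hphi : phi1 t a θ = P⁻¹ := rfl
  have hPne : P ≠ 0 := by
    intro h
    have h1 := norm_phi1_inv_sq t a θ
    rw [show (1 + (mu t a : ℂ) * (1 - Complex.exp (Complex.I * (a * θ : ℝ)))) = P from rfl, h] at h1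
    have := chd_nonneg (a * θ)
    have : 0 ≤ (mu t a + mu t a ^ 2) * chd (a * θ) := by positivity
    simp at h1
    linarith
  have e : phi1 t a θ - Complex.exp (-z) = phi1 t a θ * Complex.exp (-z) * (Complex.exp z - P) := by
    rw [hphi, Complex.exp_neg]
    have := Complex.exp_ne_zero z
    field_simp
  rw [e, norm_mul, norm_mul]
  calc _ ≤ 1 * 1 * (140 * E * v ^ 3) := by
        gcongr
        · exact norm_phi1_le_one ht a θ
        · exact norm_exp_neg_zz ht a θ
    _ = _ := by ring

lemma prod_diff_le (S : Finset ℕ) (f g : ℕ → ℂ) (hf : ∀ a ∈ S, ‖f a‖ ≤ 1)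
    (hg : ∀ a ∈ S, ‖g a‖ ≤ 1) :
    ‖∏ a ∈ S, f a - ∏ a ∈ S, g a‖ ≤ ∑ a ∈ S, ‖f a - g a‖ := by
  induction S using Finset.cons_induction with
  | empty => simp
  | cons a S ha ih =>
    rw [Finset.prod_cons, Finset.prod_cons, Finset.sum_cons]
    have h1 := ih (fun b hb => hf b (by simp [hb])) (fun b hb => hg b (by simp [hb]))
    have h2 : ‖∏ a ∈ S, f a‖ ≤ 1 := by
      rw [norm_prod]
      exact Finset.prod_le_one (fun _ _ => norm_nonneg _) (fun b hb => hf b (by simp [hb]))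
    have h3 := hg a (by simp)
    have e : f a * ∏ a ∈ S, f a - g a * ∏ a ∈ S, g a =
        (f a - g a) * ∏ a ∈ S, f a + g a * (∏ a ∈ S, f a - ∏ a ∈ S, g a) := by ring
    rw [e]
    refine (norm_add_le _ _).trans ?_
    rw [norm_mul, norm_mul]
    refine add_le_add ?_ (le_trans ?_ h1)
    · exact mul_le_of_le_one_right (norm_nonneg _) h2
    · exact mul_le_of_le_one_left (norm_nonneg _) h3

lemma hasSum_exp_pos {s : ℝ} (hs : 0 < s) :
    HasSum (fun m : ℕ => Real.exp (-(s * (m + 1 : ℕ)))) (Real.exp s - 1)⁻¹ := by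
  have h1 : Real.exp (-s) < 1 := Real.exp_lt_one_iff.mpr (by linarith)
  have h := (hasSum_geometric_of_lt_one (Real.exp_pos (-s)).le h1).mul_left (Real.exp (-s))
  have h2 : Real.exp s - 1 ≠ 0 := by have := Real.add_one_lt_exp hs.ne'; linarith
  have hf : (fun m : ℕ => Real.exp (-(s * ((m + 1 : ℕ) : ℝ)))) =
      fun i : ℕ => Real.exp (-s) * Real.exp (-s) ^ i := by
    funext m
    rw [← Real.exp_nat_mul, ← Real.exp_add]; congr 1; push_cast; ring
  have hv : (Real.exp s - 1)⁻¹ = Real.exp (-s) * (1 - Real.exp (-s))⁻¹ := by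
    have h3 : 1 - Real.exp (-s) ≠ 0 := by linarith
    have h4 : Real.exp s * Real.exp (-s) = 1 := by rw [← Real.exp_add]; simp
    rw [eq_comm, mul_inv_eq_iff_eq_mul₀ h3, eq_comm, inv_mul_eq_iff_eq_mul₀ h2]
    linear_combination -h4
  rw [hf, hv]; exact h

lemma exp_sub_one_inv_le {s : ℝ} (hs : 0 < s) : (Real.exp s - 1)⁻¹ ≤ 1 / s := by
  rw [one_div]; apply inv_anti₀ hs; linarith [Real.add_one_le_exp s]

lemma sum_exp_le {S : Finset ℕ} (hS : ∀ a ∈ S, 0 < a) {s : ℝ} (hs : 0 < s) :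
    ∑ a ∈ S, Real.exp (-(s * a)) ≤ 1 / s := by
  have h := hasSum_exp_pos hs
  have e : ∑ a ∈ S, Real.exp (-(s * a)) =
      ∑ m ∈ S.image (fun a => a - 1), Real.exp (-(s * (m + 1 : ℕ))) := by
    rw [Finset.sum_image]
    · refine Finset.sum_congr rfl fun a ha => ?_
      rw [Nat.sub_add_cancel (hS a ha)]
    · intro x hx y hy hxy
      have := hS x hx; have := hS y hy
      simp only at hxy
      omega
  rw [e]
  refine (sum_le_hasSum _ (fun _ _ => (Real.exp_pos _).le) h).trans (exp_sub_one_inv_le hs)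

noncomputable def VV (S : Finset ℕ) (t : ℝ) : ℝ := ∑ a ∈ S, (mu t a + mu t a ^ 2) * (a : ℝ) ^ 2

lemma gauss_prod (S : Finset ℕ) (t : ℝ) (n : ℕ) (hmean : ∑ a ∈ S, (a : ℝ) * mu t a = n) (θ : ℝ) :
    (∏ a ∈ S, Complex.exp (-zz t a θ)) * Complex.exp (-(Complex.I * (n * θ))) =
      ((Real.exp (-(VV S t * θ ^ 2 / 2)) : ℝ) : ℂ) := by
  rw [← Complex.exp_sum, ← Complex.exp_add, Complex.ofReal_exp]
  congr 1
  have h1 : ∑ a ∈ S, -zz t a θ = Complex.I * (((∑ a ∈ S, (a : ℝ) * mu t a : ℝ) : ℂ) * θ) -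
      ((VV S t * θ ^ 2 / 2 : ℝ) : ℂ) := by
    simp only [VV, zz]
    push_cast
    rw [Finset.sum_mul, Finset.mul_sum, Finset.sum_mul, Finset.sum_div, ← Finset.sum_sub_distrib]
    refine Finset.sum_congr rfl fun a _ => ?_
    ring
  rw [h1, hmean]
  push_cast
  ring

lemma VV_le {S : Finset ℕ} (hS : ∀ a ∈ S, 0 < a) {t : ℝ} (ht : 0 < t) : VV S t ≤ 20 / t ^ 3 := by
  calc VV S t ≤ ∑ a ∈ S, 5 / t ^ 2 * Real.exp (-(t / 4 * a)) := by
        refine Finset.sum_le_sum fun a ha => (var_le ht (hS a ha)).trans (le_of_eq ?_)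
        rw [show t / 4 * (a : ℝ) = t * a / 4 by ring]; ring
    _ ≤ 5 / t ^ 2 * (1 / (t / 4)) := by
        rw [← Finset.mul_sum]
        gcongr
        exact sum_exp_le hS (by positivity)
    _ = _ := by field_simp; norm_num

lemma prod_approx {S : Finset ℕ} (hS : ∀ a ∈ S, 0 < a) {t : ℝ} (ht : 0 < t) {θ : ℝ}
    (hθ : |θ| / t ≤ 1 / 4) :
    ‖∏ a ∈ S, phi1 t a θ - ∏ a ∈ S, Complex.exp (-zz t a θ)‖ ≤ 560 * (|θ| / t) ^ 3 / t := by
  refine (prod_diff_le S _ _ (fun a _ => norm_phi1_le_one ht a θ)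
    (fun a _ => norm_exp_neg_zz ht a θ)).trans ?_
  calc _ ≤ ∑ a ∈ S, 140 * (|θ| / t) ^ 3 * Real.exp (-(t / 4 * a)) := by
        refine Finset.sum_le_sum fun a ha => (phi1_approx ht (hS a ha) hθ).trans (le_of_eq ?_)
        rw [show t / 4 * (a : ℝ) = t * a / 4 by ring]; ring
    _ ≤ 140 * (|θ| / t) ^ 3 * (1 / (t / 4)) := by
        rw [← Finset.mul_sum]
        gcongr
        exact sum_exp_le hS (by positivity)
    _ = _ := by field_simp; ring

lemma gauss_int_lower {V τ δ : ℝ} (hτ : 0 < τ) (hτδ : τ ≤ δ) (hV : V * τ ^ 2 ≤ 20) (hV0 : 0 ≤ V) :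
    2 * τ * Real.exp (-10) ≤ ∫ θ in (-δ)..δ, Real.exp (-(V * θ ^ 2 / 2)) := by
  have hc : Continuous fun θ : ℝ => Real.exp (-(V * θ ^ 2 / 2)) := by fun_prop
  have h1 : ∫ θ in (-τ)..τ, Real.exp (-10) ≤ ∫ θ in (-τ)..τ, Real.exp (-(V * θ ^ 2 / 2)) := by
    apply intervalIntegral.integral_mono_on (by linarith) (by simp) (hc.intervalIntegrable _ _)
    intro θ hθ
    apply Real.exp_le_exp.mpr
    have : θ ^ 2 ≤ τ ^ 2 := sq_le_sq' hθ.1 hθ.2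
    nlinarith
  rw [intervalIntegral.integral_const, smul_eq_mul] at h1
  have h2 : ∫ θ in (-τ)..τ, Real.exp (-(V * θ ^ 2 / 2)) ≤ ∫ θ in (-δ)..δ, Real.exp (-(V * θ ^ 2 / 2)) := by
    apply intervalIntegral.integral_mono_interval (by linarith) (by linarith) hτδ _
      (hc.intervalIntegrable _ _)
    exact Eventually.of_forall fun θ => (Real.exp_pos _).le
  linarith

lemma exp_neg_le_pow8 {x : ℝ} (hx : 0 < x) : Real.exp (-x) ≤ 40320 / x ^ 8 := by
  have h := Real.pow_div_factorial_le_exp x hx.le 8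
  rw [Real.exp_neg, inv_le_comm₀ (Real.exp_pos _) (by positivity)]
  refine le_trans (le_of_eq ?_) h
  rw [inv_div]; norm_num [Nat.factorial]

lemma pcnt_lower {α : ℝ} (hα : 1 < α) (hirr : Irrational α) :
    ∃ u₀ > 0, ∀ u : ℝ, 0 < u → u ≤ u₀ → ∀ n : ℕ, 2 * α / u ^ 10 ≤ n →
      ∑ a ∈ bset α n, (a : ℝ) * mu (u ^ 10) a = n →
      Real.exp (HS (bset α n) (u ^ 10) + n * u ^ 10) / (2 * π) * (Real.exp (-10) * u ^ 15) ≤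
        (pcnt (bset α n) n : ℝ) := by
  obtain ⟨c, hc, t₀, ht₀, ht₀1, hb⟩ := phi_prod_bound hα hirr
  set C : ℝ := 2 * π * (40320 / c ^ 8) + 1120 with hC
  have hCpos : 0 < C := by positivity
  refine ⟨min (min t₀ (1 / 4)) (Real.exp (-10) / C), by positivity, ?_⟩
  intro u hu hu0 n hn hmean
  have hu1 : u ≤ t₀ := hu0.trans ((min_le_left _ _).trans (min_le_left _ _))
  have hu2 : u ≤ 1 / 4 := hu0.trans ((min_le_left _ _).trans (min_le_right _ _))
  have hu3 : C * u ≤ Real.exp (-10) := by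
    have := hu0.trans (min_le_right _ _)
    rw [le_div_iff₀ hCpos] at this
    linarith
  have hule : u ≤ 1 := by linarith
  set t := u ^ 10 with htd
  have ht : 0 < t := by positivity
  have htt : t ≤ t₀ := le_trans (pow_le_of_le_one hu.le hule (by norm_num)) hu1
  set S := bset α n with hS
  have hSpos : ∀ a ∈ S, 0 < a := fun a ha => by have := (mem_bset.mp ha).1.1; omega
  set δ := u ^ 14 with hδ
  have hδ0 : 0 < δ := by positivity
  have hδπ : δ ≤ π := by
    have : δ ≤ 1 := pow_le_one₀ hu.le hule
    linarith [Real.pi_gt_three]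
  set f : ℝ → ℂ := fun θ => (∏ a ∈ S, phi1 t a θ) * Complex.exp (-(Complex.I * (n * θ))) with hf
  have hfc : Continuous f := integrand_continuous ht S n
  have hfi : ∀ a b, IntervalIntegrable f MeasureTheory.volume a b := fun a b => hfc.intervalIntegrable a b
  have hfn : ∀ θ, ‖f θ‖ = ‖∏ a ∈ S, phi1 t a θ‖ := fun θ => norm_integrand t S n θ
  have hsplit : ∫ θ in (-π)..π, f θ = (∫ θ in (-π)..(-δ), f θ) + (∫ θ in (-δ)..δ, f θ) + ∫ θ in δ..π, f θ := by
    rw [intervalIntegral.integral_add_adjacent_intervals (hfi _ _) (hfi _ _),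
      intervalIntegral.integral_add_adjacent_intervals (hfi _ _) (hfi _ _)]
  -- outer bound
  set ε : ℝ := 40320 / c ^ 8 * u ^ 16 with hε
  have hout : ∀ θ, |θ| ≤ π → δ ≤ |θ| → ‖f θ‖ ≤ ε := by
    intro θ h1 h2
    rw [hfn]
    refine (hb t ht htt n hn θ h1).trans ?_
    have h3 : c / u ^ 2 ≤ c * min (θ ^ 2 / t ^ 3) (1 / t) := by
      rw [div_eq_mul_one_div]
      gcongr
      apply le_min
      · have : δ ^ 2 ≤ θ ^ 2 := by rw [← sq_abs θ]; gcongr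
        calc 1 / u ^ 2 = δ ^ 2 / t ^ 3 := by rw [hδ, htd]; field_simp
          _ ≤ _ := by gcongr
      · apply one_div_le_one_div_of_le ht
        exact pow_le_pow_of_le_one hu.le hule (by norm_num)
    calc Real.exp (-(c * min (θ ^ 2 / t ^ 3) (1 / t))) ≤ Real.exp (-(c / u ^ 2)) :=
          Real.exp_le_exp.mpr (by linarith)
      _ ≤ 40320 / (c / u ^ 2) ^ 8 := exp_neg_le_pow8 (by positivity)
      _ = ε := by rw [hε]; field_simp
  have hε0 : 0 ≤ ε := by positivity
  have ho1 : ‖∫ θ in (-π)..(-δ), f θ‖ ≤ ε * π := by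
    refine (intervalIntegral.norm_integral_le_of_norm_le_const (C := ε) ?_).trans ?_
    · intro θ hθ
      rw [Set.uIoc_of_le (by linarith)] at hθ
      have : |θ| = -θ := abs_of_nonpos (by linarith [hθ.2])
      exact hout θ (by linarith [hθ.1]) (by linarith [hθ.2])
    · gcongr
      rw [abs_of_nonneg (by linarith)]; linarith
  have ho2 : ‖∫ θ in δ..π, f θ‖ ≤ ε * π := by
    refine (intervalIntegral.norm_integral_le_of_norm_le_const (C := ε) ?_).trans ?_
    · intro θ hθ
      rw [Set.uIoc_of_le (by linarith)] at hθ
      have : |θ| = θ := abs_of_nonneg (by linarith [hθ.1])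
      exact hout θ (by linarith [hθ.2]) (by linarith [hθ.1])
    · gcongr
      rw [abs_of_nonneg (by linarith)]; linarith
  -- inner
  set g : ℝ → ℝ := fun θ => Real.exp (-(VV S t * θ ^ 2 / 2)) with hg
  have hgc : Continuous g := by rw [hg]; fun_prop
  have hin : ‖(∫ θ in (-δ)..δ, f θ) - ∫ θ in (-δ)..δ, (g θ : ℂ)‖ ≤ 560 * u ^ 2 * (2 * δ) := by
    have hgi : IntervalIntegrable (fun θ => (g θ : ℂ)) MeasureTheory.volume (-δ) δ :=
      (Complex.continuous_ofReal.comp hgc).intervalIntegrable _ _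
    rw [← intervalIntegral.integral_sub (hfi _ _) hgi]
    refine (intervalIntegral.norm_integral_le_of_norm_le_const (C := 560 * u ^ 2) ?_).trans ?_
    · intro θ hθ
      rw [Set.uIoc_of_le (by linarith)] at hθ
      have hθδ : |θ| ≤ δ := abs_le.mpr ⟨hθ.1.le, hθ.2⟩
      have h4 : |θ| / t ≤ u ^ 4 := by
        rw [div_le_iff₀ ht]; refine hθδ.trans (le_of_eq ?_); rw [hδ, htd]; ring
      have h5 : u ^ 4 ≤ 1 / 4 := le_trans (pow_le_of_le_one hu.le hule (by norm_num)) hu2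
      rw [hf, hg]
      simp only
      rw [← gauss_prod S t n hmean θ, ← sub_mul, norm_mul]
      have h6 : ‖Complex.exp (-(Complex.I * (n * θ)))‖ = 1 := by
        rw [Complex.norm_exp]; simp
      rw [h6, mul_one]
      refine (prod_approx hSpos ht (h4.trans h5)).trans ?_
      calc 560 * (|θ| / t) ^ 3 / t ≤ 560 * (u ^ 4) ^ 3 / t := by gcongr
        _ = 560 * u ^ 2 := by rw [htd]; field_simp
    · rw [abs_of_nonneg (by linarith)]; gcongr; linarith
  have hVV0 : 0 ≤ VV S t := Finset.sum_nonneg fun a _ => by have := mu_nonneg ht a; positivity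
  have hgl : 2 * u ^ 15 * Real.exp (-10) ≤ ∫ θ in (-δ)..δ, g θ := by
    apply gauss_int_lower (by positivity) _ _ hVV0
    · exact pow_le_pow_of_le_one hu.le hule (by norm_num)
    · calc VV S t * (u ^ 15) ^ 2 ≤ 20 / t ^ 3 * (u ^ 15) ^ 2 := by gcongr; exact VV_le hSpos ht
        _ = 20 := by rw [htd]; field_simp
        _ ≤ 20 := le_rfl
  have hgn : ‖∫ θ in (-δ)..δ, (g θ : ℂ)‖ = ∫ θ in (-δ)..δ, g θ := by
    rw [intervalIntegral.integral_ofReal, Complex.norm_real, Real.norm_of_nonneg]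
    exact le_trans (by positivity) hgl
  have hJ : Real.exp (-10) * u ^ 15 ≤ ‖∫ θ in (-π)..π, f θ‖ := by
    rw [hsplit]
    set I1 := ∫ θ in (-π)..(-δ), f θ
    set I2 := ∫ θ in (-δ)..δ, f θ
    set I3 := ∫ θ in δ..π, f θ
    set G := ∫ θ in (-δ)..δ, (g θ : ℂ)
    have e : G = (I1 + I2 + I3) - I1 - I3 - (I2 - G) := by ring
    have h7 : ‖G‖ ≤ ‖I1 + I2 + I3‖ + ‖I1‖ + ‖I3‖ + ‖I2 - G‖ := by
      calc ‖G‖ = ‖(I1 + I2 + I3) - I1 - I3 - (I2 - G)‖ := by rw [← e]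
        _ ≤ _ := (norm_sub_le _ _).trans (add_le_add ((norm_sub_le _ _).trans
          (add_le_add (norm_sub_le _ _) le_rfl)) le_rfl)
    rw [hgn] at h7
    have h8 : ε * π + ε * π + 560 * u ^ 2 * (2 * δ) = C * u * u ^ 15 := by
      rw [hε, hC, hδ]; ring
    have h9 : C * u * u ^ 15 ≤ Real.exp (-10) * u ^ 15 := by gcongr
    linarith
  have hp := pcnt_fourier hSpos n ht
  have hp2 : (pcnt S n : ℝ) = Real.exp (HS S t + n * t) / (2 * π) * ‖∫ θ in (-π)..π, f θ‖ := by
    have := congrArg norm hp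
    rw [Complex.norm_natCast, norm_mul, Complex.norm_real, Real.norm_of_nonneg (by positivity)] at this
    exact this
  rw [hp2]
  gcongr

lemma mean_upper {S : Finset ℕ} (hS : ∀ a ∈ S, 0 < a) {t : ℝ} (ht : 0 < t) :
    ∑ a ∈ S, (a : ℝ) * mu t a ≤ 4 / t ^ 2 := by
  calc _ ≤ ∑ a ∈ S, 1 / t * Real.exp (-(t / 4 * a)) := by
        refine Finset.sum_le_sum fun a ha => ?_
        have ha' := hS a ha
        have hx : 0 < t * a := by positivity
        have b1 := bose_le hx
        change mu t a * (t * a) ≤ _ at b1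
        have hE0 := Real.exp_pos (-(t * a / 4))
        have hE1 : Real.exp (-(t * a / 4)) ≤ 1 := Real.exp_le_one_iff.mpr (by linarith)
        rw [show t / 4 * (a : ℝ) = t * a / 4 by ring, one_div, ← div_eq_inv_mul, le_div_iff₀ ht]
        nlinarith
    _ ≤ 1 / t * (1 / (t / 4)) := by
        rw [← Finset.mul_sum]
        gcongr
        exact sum_exp_le hS (by positivity)
    _ = _ := by field_simp

lemma mean_lower {α : ℝ} (hα : 1 < α) {n : ℕ} {t : ℝ} (ht : 0 < t) (hn : 1 / t ≤ n)
    (ht2 : 2 ≤ 1 / (α * t)) :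
    1 / (4 * α * t ^ 2) ≤ ∑ a ∈ bset α n, (a : ℝ) * mu t a := by
  set M := ⌊1 / (α * t)⌋₊ with hM
  have hMle : (M : ℝ) ≤ 1 / (α * t) := Nat.floor_le (by positivity)
  have hMlt : 1 / (α * t) < M + 1 := Nat.lt_floor_add_one _
  have hfac : ∀ m ∈ Finset.Icc 1 M, 0 < bt α m ∧ (bt α m : ℝ) ≤ 1 / t := by
    intro m hm
    rw [Finset.mem_Icc] at hm
    refine ⟨lt_of_lt_of_le (by omega) (le_bt hα m), ?_⟩
    refine (bt_le hα m).trans ?_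
    have : (m : ℝ) ≤ 1 / (α * t) := le_trans (by exact_mod_cast hm.2) hMle
    calc α * m ≤ α * (1 / (α * t)) := by gcongr
      _ = 1 / t := by field_simp
  have hsub : (Finset.Icc 1 M).image (bt α) ⊆ bset α n := by
    intro a ha
    rw [Finset.mem_image] at ha
    obtain ⟨m, hm, rfl⟩ := ha
    have := hfac m hm
    rw [mem_bset]
    refine ⟨⟨this.1, by exact_mod_cast this.2.trans hn⟩, m, by rw [Finset.mem_Icc] at hm; omega, rfl⟩
  calc 1 / (4 * α * t ^ 2) ≤ ∑ m ∈ Finset.Icc 1 M, 1 / (2 * t) := by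
        rw [Finset.sum_const, Nat.card_Icc, nsmul_eq_mul, Nat.add_sub_cancel]
        calc 1 / (4 * α * t ^ 2) = (1 / (α * t) / 2) * (1 / (2 * t)) := by field_simp; norm_num
          _ ≤ M * (1 / (2 * t)) := by gcongr; linarith
    _ ≤ ∑ m ∈ Finset.Icc 1 M, (bt α m : ℝ) * mu t (bt α m) := by
        refine Finset.sum_le_sum fun m hm => ?_
        obtain ⟨h1, h2⟩ := hfac m hm
        set a := bt α m
        have hx : 0 < t * a := by positivity
        have hx1 : t * a ≤ 1 := by
          rw [le_div_iff₀ ht] at h2; linarith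
        have h3 := Real.abs_exp_sub_one_le (x := t * a) (by rw [abs_of_pos hx]; exact hx1)
        rw [abs_of_pos hx] at h3
        have h4 : 0 < Real.exp (t * a) - 1 := by have := Real.add_one_lt_exp hx.ne'; linarith
        have h5 : Real.exp (t * a) - 1 ≤ 2 * (t * a) := (le_abs_self _).trans h3
        have h6 : (2 * (t * a))⁻¹ ≤ mu t a := inv_anti₀ h4 h5
        have ha : (0:ℝ) < a := by exact_mod_cast h1
        calc 1 / (2 * t) = a * (2 * (t * a))⁻¹ := by field_simp
          _ ≤ _ := by gcongr
    _ = ∑ a ∈ (Finset.Icc 1 M).image (bt α), (a : ℝ) * mu t a := by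
        rw [Finset.sum_image]
        exact fun x _ y _ h => (bt_strictMono hα).injective h
    _ ≤ _ := by
        refine Finset.sum_le_sum_of_subset_of_nonneg hsub fun a _ _ => ?_
        have := mu_nonneg ht a
        positivity

lemma exists_tn {α : ℝ} (hα : 1 < α) {n : ℕ} (hn : 4 * α ≤ n) :
    ∃ t : ℝ, 1 / (2 * √(α * n)) ≤ t ∧ t ≤ 2 / √n ∧ ∑ a ∈ bset α n, (a : ℝ) * mu t a = n := by
  have hn0 : (0:ℝ) < n := by linarith
  have hαn : 0 < α * n := by positivity
  set l := 1 / (2 * √(α * n)) with hl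
  set r := 2 / √(n:ℝ) with hr
  have hl0 : 0 < l := by positivity
  have hlr : l ≤ r := by
    rw [hl, hr, div_le_div_iff₀ (by positivity) (by positivity)]
    have : √(n:ℝ) ≤ √(α * n) := Real.sqrt_le_sqrt (by nlinarith)
    have := Real.sqrt_nonneg (α * n)
    linarith
  have hcont : ContinuousOn (fun t : ℝ => ∑ a ∈ bset α n, (a : ℝ) * mu t a) (Set.Icc l r) := by
    apply continuousOn_finsetSum
    intro a ha
    have ha' := bset_pos ha
    apply ContinuousOn.mul continuousOn_const
    unfold mu
    apply ContinuousOn.inv₀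
    · fun_prop
    · intro t ht
      have h1 : 0 < t * a := mul_pos (lt_of_lt_of_le hl0 ht.1) (by exact_mod_cast ha')
      have := Real.add_one_lt_exp h1.ne'
      linarith
  have hinv : 1 / l = 2 * √(α * n) := by rw [hl]; simp
  have hsq : √(α * n) ^ 2 = α * n := Real.sq_sqrt hαn.le
  have hlow : (n:ℝ) ≤ ∑ a ∈ bset α n, (a : ℝ) * mu l a := by
    have h := mean_lower hα (n := n) hl0 ?_ ?_
    · refine le_trans (le_of_eq ?_) h
      have : l ^ 2 = 1 / (4 * (α * n)) := by rw [hl, div_pow, mul_pow, hsq]; norm_num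
      rw [this]; field_simp
    · rw [hinv]
      have : √(α * n) ≤ n / 2 := Real.sqrt_le_iff.mpr ⟨by positivity, by nlinarith⟩
      linarith
    · rw [show 1 / (α * l) = 1 / l / α by field_simp, hinv, le_div_iff₀ (by linarith)]
      have : α ≤ √(α * n) := Real.le_sqrt_of_sq_le (by nlinarith)
      linarith
  have hup : ∑ a ∈ bset α n, (a : ℝ) * mu r a ≤ n := by
    refine (mean_upper (fun a ha => bset_pos ha) (lt_of_lt_of_le hl0 hlr)).trans (le_of_eq ?_)
    rw [hr, div_pow, Real.sq_sqrt hn0.le]; field_simp; try norm_num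
  obtain ⟨t, ht, hte⟩ := intermediate_value_Icc' hlr hcont ⟨hup, hlow⟩
  exact ⟨t, ht.1, ht.2, hte⟩

lemma exists_mult {α : ℝ} (hirr : Irrational α) {x y : ℝ} (hxy : x < y) :
    ∃ r : ℕ, ∃ k : ℤ, x < r * α - k ∧ r * α - k < y := by
  have h1 : DenseRange (· • (α : AddCircle (1:ℝ)) : ℤ → AddCircle (1:ℝ)) :=
    AddCircle.denseRange_zsmul_coe_iff.mpr (by simpa using hirr)
  have : Fact ((0:ℝ) < 1) := ⟨one_pos⟩
  have h2 : DenseRange (· • (α : AddCircle (1:ℝ)) : ℕ → AddCircle (1:ℝ)) := denseRange_zsmul_iff_nsmul.mp h1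
  have hopen : IsOpen ((fun z : ℝ => (z : AddCircle (1:ℝ))) '' Set.Ioo x y) :=
    QuotientAddGroup.isOpenMap_coe _ isOpen_Ioo
  obtain ⟨r, z, hz, hze⟩ := h2.exists_mem_open hopen ((Set.nonempty_Ioo.mpr hxy).image _)
  have h3 : ((r * α - z : ℝ) : AddCircle (1:ℝ)) = 0 := by
    simp only at hze
    rw [AddCircle.coe_sub, hze, ← AddCircle.coe_nsmul, nsmul_eq_mul, sub_self]
  rw [AddCircle.coe_eq_zero_iff] at h3
  obtain ⟨k, hk⟩ := h3
  refine ⟨r, k, ?_, ?_⟩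
  · simp at hk; have := hz.1; linarith
  · simp at hk; have := hz.2; linarith

lemma fract_sum_le {Q : ℕ} (hQ : 0 < Q) {d : ℝ} (h1 : 1 / (Q:ℝ) ≤ d) (h2 : d ≤ 1 / (Q:ℝ) + 1 / (Q:ℝ) ^ 2)
    (y : ℝ) : ∑ j ∈ Finset.range Q, Int.fract (y + j * d) ≤ Q / 2 + 1 := by
  set f := Int.fract y with hf
  have hf0 : 0 ≤ f := Int.fract_nonneg y
  have hf1 : f < 1 := Int.fract_lt_one y
  have hQ' : (0:ℝ) < Q := by exact_mod_cast hQ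
  have hd : 0 ≤ d := le_trans (by positivity) h1
  set q := ⌊Q * f⌋₊ with hq
  have hq1 : (q:ℝ) ≤ Q * f := Nat.floor_le (by positivity)
  have hq2 : Q * f < q + 1 := Nat.lt_floor_add_one _
  have hqQ : q < Q := by
    have : (q:ℝ) < Q := by nlinarith
    exact_mod_cast this
  have hterm : ∀ j ∈ Finset.range Q, Int.fract (y + j * d) ≤ f + j * d - (if Q - q ≤ j then 1 else 0) := by
    intro j _
    have e : Int.fract (y + j * d) = Int.fract (f + j * d) := by
      rw [hf, show y + j * d = (Int.fract y + j * d) + (⌊y⌋ : ℤ) by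
        have := Int.fract_add_floor y; linarith, Int.fract_add_intCast]
    rw [e]
    have hle : ∀ x : ℝ, 0 ≤ x → Int.fract x ≤ x := by
      intro x hx
      have : (0:ℝ) ≤ (⌊x⌋:ℝ) := by exact_mod_cast Int.floor_nonneg.mpr hx
      have := Int.fract_add_floor x
      linarith
    split_ifs with h
    · have h3 : (0:ℝ) ≤ f + j * d - 1 := by
        have hj : (Q:ℝ) ≤ j + q := by exact_mod_cast (by omega : Q ≤ j + q)
        have : (j:ℝ) * (1 / Q) ≤ j * d := by gcongr
        have h5 : (j:ℝ) / Q + q / Q ≥ 1 := by rw [← add_div, ge_iff_le, le_div_iff₀ hQ']; linarith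
        have h6 : (q:ℝ) / Q ≤ f := by rw [div_le_iff₀ hQ']; linarith
        rw [mul_one_div] at this
        linarith
      have := hle _ h3
      rwa [Int.fract_sub_one] at this
    · rw [sub_zero]; exact hle _ (by positivity)
  refine (Finset.sum_le_sum hterm).trans ?_
  rw [Finset.sum_sub_distrib, Finset.sum_add_distrib, Finset.sum_const, Finset.card_range, nsmul_eq_mul,
    ← Finset.sum_mul]
  have hc : ∑ j ∈ Finset.range Q, (if Q - q ≤ j then (1:ℝ) else 0) = q := by
    rw [Finset.sum_boole]
    have : (Finset.range Q).filter (fun j => Q - q ≤ j) = Finset.Ico (Q - q) Q := by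
      ext j; simp; omega
    rw [this, Nat.card_Ico, Nat.sub_sub_self hqQ.le]
  have hg : ∑ j ∈ Finset.range Q, (j:ℝ) = Q * (Q - 1) / 2 := by
    have := Finset.sum_range_id_mul_two Q
    have h7 : ((∑ j ∈ Finset.range Q, j : ℕ):ℝ) * 2 = Q * ((Q - 1 : ℕ):ℝ) := by exact_mod_cast this
    rw [Nat.cast_sub hQ] at h7
    push_cast at h7
    linarith
  rw [hc, hg]
  have hQ1 : (1:ℝ) ≤ Q := by exact_mod_cast hQ
  have h8 : (Q:ℝ) * (Q - 1) / 2 * d ≤ Q * (Q - 1) / 2 * (1 / (Q:ℝ) + 1 / (Q:ℝ) ^ 2) := by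
    have : (0:ℝ) ≤ Q - 1 := by linarith
    gcongr
  have h9 : (Q:ℝ) * (Q - 1) / 2 * (1 / (Q:ℝ) + 1 / (Q:ℝ) ^ 2) = Q / 2 - 1 / (2 * Q) := by
    field_simp; ring
  have : 0 ≤ 1 / (2 * (Q:ℝ)) := by positivity
  linarith

lemma summable_bdd {F : ℕ → ℝ} (hF0 : ∀ m, 0 ≤ F m) (hF1 : ∀ m, F m ≤ 1) {w : ℝ} (hw0 : 0 ≤ w) (hw1 : w < 1) :
    Summable fun m => F m * w ^ m := by
  refine Summable.of_nonneg_of_le (fun m => mul_nonneg (hF0 m) (by positivity))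
    (fun m => ?_) (summable_geometric_of_lt_one hw0 hw1)
  exact mul_le_of_le_one_left (by positivity) (hF1 m)

lemma shift_le {F : ℕ → ℝ} (hF0 : ∀ m, 0 ≤ F m) (hF1 : ∀ m, F m ≤ 1) {w : ℝ} (hw0 : 0 ≤ w) (hw1 : w < 1)
    (k : ℕ) : ∑' m, F m * w ^ m ≤ k + ∑' m, F (m + k) * w ^ m := by
  have hs := summable_bdd hF0 hF1 hw0 hw1
  rw [← hs.sum_add_tsum_nat_add k]
  apply add_le_add
  · calc _ ≤ ∑ i ∈ Finset.range k, (1:ℝ) := Finset.sum_le_sum fun i _ =>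
          mul_le_one₀ (hF1 i) (by positivity) (pow_le_one₀ hw0 hw1.le)
      _ = k := by simp
  · apply Summable.tsum_le_tsum _ ((summable_nat_add_iff k).mpr hs)
      (summable_bdd (fun m => hF0 (m + k)) (fun m => hF1 (m + k)) hw0 hw1)
    intro m
    have := hF0 (m + k)
    gcongr ?_ * ?_
    exact pow_le_pow_of_le_one hw0 hw1.le (by omega)

lemma abel_upper {α : ℝ} (hirr : Irrational α) {ε : ℝ} (hε : 0 < ε) :
    ∃ η > 0, ∀ w : ℝ, 0 ≤ w → w < 1 → 1 - w ≤ η →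
      (1 - w) * ∑' m : ℕ, Int.fract (α * m) * w ^ m ≤ 1 / 2 + ε := by
  obtain ⟨Q, hQ⟩ := exists_nat_gt (2 / ε)
  have hQ' : (0:ℝ) < Q := lt_trans (by positivity) hQ
  have hQ0 : 0 < Q := by exact_mod_cast hQ'
  obtain ⟨r, k, hr1, hr2⟩ := exists_mult hirr (x := 1 / (Q:ℝ)) (y := 1 / (Q:ℝ) + 1 / (Q:ℝ) ^ 2)
    (by linarith [show (0:ℝ) < 1 / (Q:ℝ) ^ 2 by positivity])
  refine ⟨ε / (2 * (Q * r + 1)), by positivity, fun w hw0 hw1 hwη => ?_⟩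
  set F : ℕ → ℝ := fun m => Int.fract (α * m) with hF
  have hF0 : ∀ m, 0 ≤ F m := fun m => Int.fract_nonneg _
  have hF1 : ∀ m, F m ≤ 1 := fun m => (Int.fract_lt_one _).le
  have h1 : Q * ∑' m, F m * w ^ m ≤ Q * (Q * r) + (Q / 2 + 1) * (1 - w)⁻¹ := by
    calc Q * ∑' m, F m * w ^ m = ∑ j ∈ Finset.range Q, ∑' m, F m * w ^ m := by simp
      _ ≤ ∑ j ∈ Finset.range Q, ((Q * r : ℝ) + ∑' m, F (m + j * r) * w ^ m) := by
          refine Finset.sum_le_sum fun j hj => (shift_le hF0 hF1 hw0 hw1 (j * r)).trans ?_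
          gcongr
          push_cast
          gcongr
          exact (Finset.mem_range.mp hj).le
      _ = Q * (Q * r) + ∑ j ∈ Finset.range Q, ∑' m, F (m + j * r) * w ^ m := by
          rw [Finset.sum_add_distrib]; simp
      _ = Q * (Q * r) + ∑' m, ∑ j ∈ Finset.range Q, F (m + j * r) * w ^ m := by
          rw [Summable.tsum_finsetSum]
          intro j _
          exact summable_bdd (fun m => hF0 _) (fun m => hF1 _) hw0 hw1
      _ ≤ Q * (Q * r) + ∑' m : ℕ, (Q / 2 + 1) * w ^ m := by
          refine add_le_add le_rfl ?_
          apply Summable.tsum_le_tsum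
          · intro m
            rw [← Finset.sum_mul]
            gcongr
            refine le_trans (le_of_eq ?_) (fract_sum_le hQ0 hr1.le hr2.le (α * m))
            refine Finset.sum_congr rfl fun j _ => ?_
            rw [hF]
            simp only
            rw [show α * ((m + j * r : ℕ) : ℝ) = (α * m + j * (r * α - k)) + ((j * k : ℤ) : ℝ) by
              push_cast; ring, Int.fract_add_intCast]
          · exact summable_sum fun j _ => summable_bdd (fun m => hF0 _) (fun m => hF1 _) hw0 hw1
          · exact (summable_geometric_of_lt_one hw0 hw1).mul_left _
      _ = _ := by rw [tsum_mul_left, tsum_geometric_of_lt_one hw0 hw1]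
  have hw : 0 < 1 - w := by linarith
  set T := ∑' m, F m * w ^ m
  have h2 : Q * ((1 - w) * T) ≤ Q * (Q * r * (1 - w)) + (Q / 2 + 1) := by
    have := mul_le_mul_of_nonneg_left h1 hw.le
    have e : (1 - w) * (Q * (Q * r) + (Q / 2 + 1) * (1 - w)⁻¹) = Q * (Q * r * (1 - w)) + (Q / 2 + 1) := by
      field_simp
    linarith
  have h3 : (Q:ℝ) * r * (1 - w) ≤ ε / 2 := by
    rw [le_div_iff₀ (by positivity)] at hwη
    nlinarith
  have h4 : 1 ≤ Q * (ε / 2) := by rw [div_lt_iff₀ hε] at hQ; linarith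
  have h5 : Q * ((1 - w) * T) ≤ Q * (1 / 2 + ε) := by
    have := mul_le_mul_of_nonneg_left h3 hQ'.le
    linarith
  exact le_of_mul_le_mul_left h5 hQ'

lemma abel_lim {α : ℝ} (hirr : Irrational α) {ε : ℝ} (hε : 0 < ε) :
    ∃ η > 0, ∀ w : ℝ, 0 ≤ w → w < 1 → 1 - w ≤ η →
      |(1 - w) * (∑' m : ℕ, Int.fract (α * m) * w ^ m) - 1 / 2| ≤ ε := by
  obtain ⟨η1, hη1, H1⟩ := abel_upper hirr hε
  obtain ⟨η2, hη2, H2⟩ := abel_upper hirr.neg (half_pos hε)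
  refine ⟨min η1 (min η2 (ε / 2)), by positivity, fun w hw0 hw1 hw => ?_⟩
  have a1 := H1 w hw0 hw1 (hw.trans (min_le_left _ _))
  have a2 := H2 w hw0 hw1 (hw.trans ((min_le_right _ _).trans (min_le_left _ _)))
  have a3 : 1 - w ≤ ε / 2 := hw.trans ((min_le_right _ _).trans (min_le_right _ _))
  have hsum : ∀ m : ℕ, 1 * w ^ m - (if m = 0 then 1 else 0) = Int.fract (α * m) * w ^ m + Int.fract (-α * m) * w ^ m := by
    intro m
    rcases Nat.eq_zero_or_pos m with rfl | hm
    · simp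
    · have hne : Int.fract (α * m) ≠ 0 := by
        have : Irrational (α * m) := hirr.mul_natCast hm.ne'
        intro h
        rw [Int.fract, sub_eq_zero] at h
        exact this.ne_int _ h
      rw [neg_mul, Int.fract_neg hne, if_neg hm.ne']
      ring
  have s0 : Summable fun m : ℕ => (1:ℝ) * w ^ m := (summable_geometric_of_lt_one hw0 hw1).mul_left _
  have s1 : Summable fun m : ℕ => Int.fract (α * m) * w ^ m :=
    summable_bdd (fun m => Int.fract_nonneg _) (fun m => (Int.fract_lt_one _).le) hw0 hw1
  have s2 : Summable fun m : ℕ => Int.fract (-α * m) * w ^ m :=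
    summable_bdd (fun m => Int.fract_nonneg _) (fun m => (Int.fract_lt_one _).le) hw0 hw1
  have hd : HasSum (fun m : ℕ => if m = 0 then (1:ℝ) else 0) 1 := hasSum_ite_eq 0 1
  have ht : (1 - w)⁻¹ - 1 = (∑' m : ℕ, Int.fract (α * m) * w ^ m) + ∑' m : ℕ, Int.fract (-α * m) * w ^ m := by
    rw [← s1.tsum_add s2, ← tsum_congr hsum, s0.tsum_sub hd.summable, hd.tsum_eq, tsum_mul_left,
      tsum_geometric_of_lt_one hw0 hw1, one_mul]
  have hw' : 1 - w ≠ 0 := by linarith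
  have h6 : (1 - w) * ((1 - w)⁻¹ - 1) = 1 - (1 - w) := by rw [mul_sub, mul_inv_cancel₀ hw', mul_one]
  rw [ht, mul_add] at h6
  rw [abs_le]
  constructor <;> linarith

lemma inv_one_sub_exp {x : ℝ} (hx : 0 < x) (hx1 : x ≤ 1) :
    |(1 - Real.exp (-x))⁻¹ - 1 / x - 1 / 2| ≤ 2 * x := by
  have hb := Real.exp_bound (x := -x) (by rw [abs_neg, abs_of_pos hx]; exact hx1) (n := 3) (by norm_num)
  have e1 : ∑ m ∈ Finset.range 3, (-x) ^ m / (m.factorial : ℝ) = 1 - x + x ^ 2 / 2 := by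
    simp [Finset.sum_range_succ, Nat.factorial]; ring
  rw [e1, abs_neg, abs_of_pos hx] at hb
  norm_num [Nat.factorial] at hb
  set R := Real.exp (-x) - (1 - x + x ^ 2 / 2) with hR
  have hRb : |R| ≤ x ^ 3 * (2 / 9) := hb
  have hD : 1 - Real.exp (-x) = x - x ^ 2 / 2 - R := by rw [hR]; ring
  have hDlow : x / 4 ≤ x - x ^ 2 / 2 - R := by
    have := (abs_le.mp hRb).2
    have h2 : x ^ 2 ≤ x := by nlinarith
    have h3 : x ^ 3 ≤ x := by nlinarith
    linarith
  rw [hD]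
  set D := x - x ^ 2 / 2 - R with hDd
  have hD0 : 0 < D := by linarith
  have e2 : D⁻¹ - 1 / x - 1 / 2 = (x ^ 3 / 2 + (2 + x) * R) / (2 * x * D) := by
    field_simp
    rw [hDd]; ring
  rw [e2, abs_div, abs_of_pos (show 0 < 2 * x * D by positivity), div_le_iff₀ (by positivity)]
  have h4 : |x ^ 3 / 2 + (2 + x) * R| ≤ x ^ 3 / 2 + 3 * (x ^ 3 * (2 / 9)) := by
    refine (abs_add_le _ _).trans ?_
    rw [abs_mul, abs_of_pos (show 0 < x ^ 3 / 2 by positivity), abs_of_pos (show 0 < 2 + x by positivity)]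
    gcongr
    linarith
  have hD2 : x * (1 - 1 / 2 - 2 / 9) ≤ D := by
    have := (abs_le.mp hRb).2
    have h2 : x ^ 2 ≤ x := by nlinarith
    have h3 : x ^ 3 ≤ x := by nlinarith
    linarith
  have hD3 : 2 * x * (2 * x * D) ≥ 2 * x * (2 * x * (x * (5 / 18))) := by
    gcongr; linarith
  have h6 : D ≥ x * (1 - x / 2 - x / 4) := by
    have := (abs_le.mp hRb).2
    have h3 : x ^ 3 ≤ x ^ 2 := by nlinarith [sq_nonneg x]
    nlinarith
  rcases le_or_gt x (1 / 2) with h | h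
  · have : 2 * x * (2 * x * D) ≥ 2 * x * (2 * x * (x * (5 / 8))) := by
      gcongr
      refine le_trans ?_ h6
      gcongr; linarith
    nlinarith [pow_pos hx 3]
  · have hD4 : x * (5 / 18) ≤ D := by linarith
    have hD5 : 1 - Real.exp (-x) = D := hD
    have h7 : x / (1 + x) ≤ D := by
      rw [← hD5, Real.exp_neg]
      have h8 := Real.add_one_le_exp x
      have h9 : (Real.exp x)⁻¹ ≤ (x + 1)⁻¹ := inv_anti₀ (by linarith) h8
      have : x / (1 + x) = 1 - (x + 1)⁻¹ := by field_simp; ring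
      linarith
    have h10 : x / 2 ≤ D := le_trans (by gcongr; linarith) h7
    have : 2 * x * (2 * x * D) ≥ 2 * x * (2 * x * (x / 2)) := by gcongr
    nlinarith [pow_pos hx 3]

noncomputable def EE (α s : ℝ) : ℝ := ∑' m : ℕ, Real.exp (-(s * bt α (m + 1)))

lemma bt_eq {α : ℝ} (hα : 1 < α) (m : ℕ) : (bt α m : ℝ) = α * m - Int.fract (α * m) := by
  have h : (0:ℝ) ≤ α * m := by positivity
  unfold bt
  rw [natCast_floor_eq_intCast_floor h]
  have := Int.fract_add_floor (α * m)
  linarith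

lemma bt_zero (α : ℝ) : bt α 0 = 0 := by simp [bt]

lemma summable_bt0 {α s : ℝ} (hα : 1 < α) (hs : 0 < s) :
    Summable fun m : ℕ => Real.exp (-(s * bt α m)) := by
  have h1 : Real.exp (-s) < 1 := Real.exp_lt_one_iff.mpr (by linarith)
  refine Summable.of_nonneg_of_le (fun m => (Real.exp_pos _).le) (fun m => ?_)
    (summable_geometric_of_lt_one (Real.exp_pos (-s)).le h1)
  rw [← Real.exp_nat_mul]
  apply Real.exp_le_exp.mpr
  have : (m:ℝ) ≤ bt α m := by exact_mod_cast le_bt hα m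
  nlinarith

lemma EE_nonneg (α s : ℝ) : 0 ≤ EE α s := tsum_nonneg fun _ => (Real.exp_pos _).le

lemma EE_le {α s : ℝ} (hα : 1 < α) (hs : 0 < s) : EE α s ≤ 1 / s := by
  have h := hasSum_exp_pos hs
  refine le_trans ?_ (exp_sub_one_inv_le hs)
  rw [← h.tsum_eq]
  refine Summable.tsum_le_tsum (fun m => ?_) ((summable_nat_add_iff 1).mpr (summable_bt0 hα hs)) h.summable
  apply Real.exp_le_exp.mpr
  have : ((m + 1 : ℕ):ℝ) ≤ bt α (m + 1) := by exact_mod_cast le_bt hα (m + 1)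
  nlinarith

lemma EE_sandwich {α s : ℝ} (hα : 1 < α) (hs : 0 < s) (hs1 : s ≤ 1) :
    let w := Real.exp (-(s * α))
    let T := ∑' m : ℕ, Int.fract (α * m) * w ^ m
    (1 - w)⁻¹ + s * T - 1 ≤ EE α s ∧ EE α s ≤ (1 - w)⁻¹ + s * T + s * (s * (1 - w)⁻¹) - 1 := by
  intro w T
  have hw0 : 0 ≤ w := (Real.exp_pos _).le
  have hw1 : w < 1 := Real.exp_lt_one_iff.mpr (by have : 0 < s * α := by positivity
                                                  linarith)
  have hsum := summable_bt0 hα hs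
  have hE : EE α s = (∑' m : ℕ, Real.exp (-(s * bt α m))) - 1 := by
    rw [hsum.tsum_eq_zero_add, bt_zero]; simp [EE]
  have sg := summable_geometric_of_lt_one hw0 hw1
  have hg := tsum_geometric_of_lt_one hw0 hw1
  have sF : Summable fun m : ℕ => Int.fract (α * m) * w ^ m :=
    summable_bdd (fun m => Int.fract_nonneg _) (fun m => (Int.fract_lt_one _).le) hw0 hw1
  have hterm : ∀ m : ℕ, Real.exp (-(s * bt α m)) = w ^ m * Real.exp (s * Int.fract (α * m)) := by
    intro m
    rw [bt_eq hα, ← Real.exp_nat_mul, ← Real.exp_add]; congr 1; ring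
  have hlow : (1 - w)⁻¹ + s * T = ∑' m : ℕ, (w ^ m + s * (Int.fract (α * m) * w ^ m)) := by
    rw [sg.tsum_add (sF.mul_left s), hg, tsum_mul_left]
  have hup : (1 - w)⁻¹ + s * T + s * (s * (1 - w)⁻¹) =
      ∑' m : ℕ, (w ^ m + s * (Int.fract (α * m) * w ^ m) + s ^ 2 * w ^ m) := by
    rw [(sg.add (sF.mul_left s)).tsum_add (sg.mul_left _), sg.tsum_add (sF.mul_left s), hg, tsum_mul_left,
      tsum_mul_left, hg]; ring
  rw [hE, hup, hlow]
  have hf0 : ∀ m : ℕ, 0 ≤ Int.fract (α * m) := fun m => Int.fract_nonneg _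
  have hf1 : ∀ m : ℕ, Int.fract (α * m) ≤ 1 := fun m => (Int.fract_lt_one _).le
  constructor
  · refine sub_le_sub_right (Summable.tsum_le_tsum (fun m => ?_) (sg.add (sF.mul_left s)) hsum) 1
    rw [hterm]
    have := Real.add_one_le_exp (s * Int.fract (α * m))
    have h3 : 0 ≤ w ^ m := by positivity
    nlinarith
  · refine sub_le_sub_right (Summable.tsum_le_tsum (fun m => ?_) hsum
      ((sg.add (sF.mul_left s)).add (sg.mul_left _))) 1
    rw [hterm]
    have h0 : 0 ≤ s * Int.fract (α * m) := mul_nonneg hs.le (hf0 m)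
    have h1 : s * Int.fract (α * m) ≤ s := mul_le_of_le_one_right hs.le (hf1 m)
    have := Real.abs_exp_sub_one_sub_id_le (x := s * Int.fract (α * m)) (by rw [abs_of_nonneg h0]; linarith)
    have h4 := (abs_le.mp this).2
    have h5 : (s * Int.fract (α * m)) ^ 2 ≤ s ^ 2 := by gcongr
    have h3 : 0 ≤ w ^ m := by positivity
    nlinarith

lemma EE_tendsto {α : ℝ} (hα : 1 < α) (hirr : Irrational α) :
    Tendsto (fun s => EE α s - 1 / (α * s)) (𝓝[>] 0) (𝓝 (-(1 / 2 - 1 / (2 * α)))) := by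
  have hα0 : 0 < α := by linarith
  set w : ℝ → ℝ := fun s => Real.exp (-(s * α)) with hw
  set T : ℝ → ℝ := fun s => ∑' m : ℕ, Int.fract (α * m) * (w s) ^ m with hT
  have hid : Tendsto (fun s : ℝ => s) (𝓝[>] 0) (𝓝 0) := nhdsWithin_le_nhds
  have hpos : ∀ᶠ s : ℝ in 𝓝[>] 0, 0 < s := self_mem_nhdsWithin
  have hwt : Tendsto (fun s => 1 - w s) (𝓝[>] 0) (𝓝 0) := by
    have : Continuous fun s => 1 - w s := by rw [hw]; fun_prop
    have h := (this.tendsto 0).mono_left (nhdsWithin_le_nhds (s := Set.Ioi (0:ℝ)))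
    simpa [hw] using h
  have hw1 : ∀ s, 0 < s → w s < 1 := fun s hs => Real.exp_lt_one_iff.mpr (by
    have : 0 < s * α := by positivity
    linarith)
  have habel : Tendsto (fun s => (1 - w s) * T s) (𝓝[>] 0) (𝓝 (1 / 2)) := by
    rw [Metric.tendsto_nhds]
    intro ε hε
    obtain ⟨η, hη, H⟩ := abel_lim hirr (half_pos hε)
    filter_upwards [hpos, hwt.eventually (gt_mem_nhds hη)] with s hs h1
    rw [Real.dist_eq]
    exact lt_of_le_of_lt (H (w s) (Real.exp_pos _).le (hw1 s hs) h1.le) (by linarith)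
  have hL : Tendsto (fun s => (1 - w s)⁻¹ - 1 / (α * s)) (𝓝[>] 0) (𝓝 (1 / 2)) := by
    have hz : Tendsto (fun s : ℝ => 2 * (s * α)) (𝓝[>] 0) (𝓝 0) := by
      simpa using (hid.mul_const α).const_mul 2
    have hsm : ∀ᶠ s : ℝ in 𝓝[>] 0, s * α < 1 := by
      have : Tendsto (fun s : ℝ => s * α) (𝓝[>] 0) (𝓝 0) := by simpa using hid.mul_const α
      exact this.eventually (gt_mem_nhds one_pos)
    have : Tendsto (fun s => ((1 - w s)⁻¹ - 1 / (α * s)) - 1 / 2) (𝓝[>] 0) (𝓝 0) := by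
      apply squeeze_zero_norm' _ hz
      filter_upwards [hpos, hsm] with s hs h1
      rw [Real.norm_eq_abs, mul_comm α s]
      exact inv_one_sub_exp (by positivity) h1.le
    have h2 := this.add_const (1 / 2)
    simp only [sub_add_cancel, zero_add] at h2
    exact h2
  have hsL : Tendsto (fun s => s * (1 - w s)⁻¹) (𝓝[>] 0) (𝓝 (1 / α)) := by
    have h1 : Tendsto (fun s => s * ((1 - w s)⁻¹ - 1 / (α * s)) + 1 / α) (𝓝[>] 0) (𝓝 (0 * (1 / 2) + 1 / α)) :=
      (hid.mul hL).add_const _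
    rw [zero_mul, zero_add] at h1
    refine h1.congr' ?_
    filter_upwards [hpos] with s hs
    field_simp
    ring
  have hlow : Tendsto (fun s => ((1 - w s)⁻¹ - 1 / (α * s)) + s * (1 - w s)⁻¹ * ((1 - w s) * T s) - 1) (𝓝[>] 0)
      (𝓝 (1 / 2 + 1 / α * (1 / 2) - 1)) := (hL.add (hsL.mul habel)).sub_const 1
  have hup : Tendsto (fun s => (((1 - w s)⁻¹ - 1 / (α * s)) + s * (1 - w s)⁻¹ * ((1 - w s) * T s) - 1) +
      s * (s * (1 - w s)⁻¹)) (𝓝[>] 0) (𝓝 ((1 / 2 + 1 / α * (1 / 2) - 1) + 0 * (1 / α))) := hlow.add (hid.mul hsL)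
  have elim : (1 / 2 + 1 / α * (1 / 2) - 1 : ℝ) = -(1 / 2 - 1 / (2 * α)) := by field_simp; ring
  rw [zero_mul, add_zero, elim] at hup
  rw [elim] at hlow
  have hs1 : ∀ᶠ s : ℝ in 𝓝[>] 0, s < 1 := hid.eventually (gt_mem_nhds one_pos)
  have hcanc : ∀ s, 0 < s → s * (1 - w s)⁻¹ * ((1 - w s) * T s) = s * T s := by
    intro s hs
    have : 1 - w s ≠ 0 := by have := hw1 s hs; linarith
    field_simp
  refine tendsto_of_tendsto_of_tendsto_of_le_of_le' hlow hup ?_ ?_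
  · filter_upwards [hpos, hs1] with s hs h1
    have := (EE_sandwich hα hs h1.le).1
    change (1 - w s)⁻¹ + s * T s - 1 ≤ _ at this
    rw [hcanc s hs]; linarith
  · filter_upwards [hpos, hs1] with s hs h1
    have := (EE_sandwich hα hs h1.le).2
    change _ ≤ (1 - w s)⁻¹ + s * T s + s * (s * (1 - w s)⁻¹) - 1 at this
    rw [hcanc s hs]; linarith

noncomputable def HH (α t : ℝ) : ℝ := ∑' m : ℕ, hh (t * bt α (m + 1))

lemma hasSum_hh {x : ℝ} (hx : 0 < x) :
    HasSum (fun k : ℕ => Real.exp (-(x * (k + 1))) / (k + 1)) (hh x) := by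
  have h1 : Real.exp (-x) < 1 := Real.exp_lt_one_iff.mpr (by linarith)
  have h := Real.hasSum_pow_div_log_of_abs_lt_one (x := Real.exp (-x))
    (by rw [abs_of_pos (Real.exp_pos _)]; exact h1)
  have e : (fun k : ℕ => Real.exp (-(x * (k + 1))) / (k + 1)) =
      fun k : ℕ => Real.exp (-x) ^ (k + 1) / ((k : ℝ) + 1) := by
    funext k
    rw [← Real.exp_nat_mul]; congr 2; push_cast; ring
  rw [e]
  exact h

lemma hasSum_zeta' : HasSum (fun k : ℕ => 1 / ((k : ℝ) + 1) ^ 2) (π ^ 2 / 6) := by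
  have := (hasSum_nat_add_iff' 1).mpr hasSum_zeta_two
  simpa using this

lemma tail_zeta {K : ℕ} (hK : 0 < K) : ∑' k : ℕ, 1 / (((k + K : ℕ) : ℝ) + 1) ^ 2 ≤ 1 / (K : ℝ) := by
  apply Real.tsum_le_of_sum_range_le (fun n => by positivity)
  intro N
  have hK' : (0:ℝ) < K := by exact_mod_cast hK
  have : ∀ N : ℕ, ∑ k ∈ Finset.range N, 1 / (((k + K : ℕ) : ℝ) + 1) ^ 2 ≤ 1 / K - 1 / (K + N : ℝ) := by
    intro N
    induction N with
    | zero => simp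
    | succ N ih =>
      rw [Finset.sum_range_succ]
      have : 1 / (((N + K : ℕ) : ℝ) + 1) ^ 2 ≤ 1 / (K + N : ℝ) - 1 / (K + (N + 1 : ℕ) : ℝ) := by
        push_cast
        have hp : (0:ℝ) < K + N := by positivity
        rw [div_sub_div _ _ (by positivity) (by positivity), div_le_div_iff₀ (by positivity) (by positivity)]
        nlinarith
      linarith
  have h := this N
  have : (0:ℝ) ≤ 1 / (K + N : ℝ) := by positivity
  linarith

lemma HH_eq {α t : ℝ} (hα : 1 < α) (ht : 0 < t) :
    Summable (fun m : ℕ => hh (t * bt α (m + 1))) ∧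
    HasSum (fun k : ℕ => EE α ((k + 1) * t) / (k + 1)) (HH α t) := by
  set f : ℕ × ℕ → ℝ := fun p => Real.exp (-(t * bt α (p.2 + 1) * (p.1 + 1))) / (p.1 + 1) with hf
  have hf0 : 0 ≤ f := fun p => by simp only [hf, Pi.zero_apply]; positivity
  have hrow : ∀ k : ℕ, HasSum (fun m => f (k, m)) (EE α ((k + 1) * t) / (k + 1)) := by
    intro k
    have hs : 0 < ((k:ℝ) + 1) * t := by positivity
    have := ((summable_nat_add_iff 1).mpr (summable_bt0 hα hs)).hasSum.div_const ((k:ℝ) + 1)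
    refine this.congr_fun ?_ 
    intro m
    simp only [hf]
    congr 3
    ring
  have hsum2 : Summable fun k : ℕ => EE α ((k + 1) * t) / (k + 1) := by
    refine Summable.of_nonneg_of_le (fun k => div_nonneg (EE_nonneg _ _) (by positivity)) (fun k => ?_)
      (hasSum_zeta'.summable.mul_right (1 / t))
    have hs : 0 < ((k:ℝ) + 1) * t := by positivity
    calc EE α ((k + 1) * t) / (k + 1) ≤ 1 / ((k + 1) * t) / (k + 1) := by gcongr; exact EE_le hα hs
      _ = 1 / ((k : ℝ) + 1) ^ 2 * (1 / t) := by field_simp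
  have hS : Summable f := by
    rw [summable_prod_of_nonneg hf0]
    refine ⟨fun k => (hrow k).summable, ?_⟩
    simpa only [(hrow _).tsum_eq] using hsum2
  have hcol : ∀ m : ℕ, HasSum (fun k => f (k, m)) (hh (t * bt α (m + 1))) := by
    intro m
    have : 0 < bt α (m + 1) := lt_of_lt_of_le (by omega) (le_bt hα (m + 1))
    have hx : 0 < t * (bt α (m + 1) : ℝ) := by positivity
    have h := hasSum_hh hx
    simp only [hf]
    exact h
  have hS' := hS.prod_symm
  have h3 : HasSum (fun m => hh (t * bt α (m + 1))) (∑' p, f p) := by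
    have := hS'.hasSum.prod_fiberwise (fun m => hcol m)
    rwa [show ∑' p : ℕ × ℕ, f p.swap = ∑' p, f p from (Equiv.prodComm ℕ ℕ).tsum_eq f] at this
  refine ⟨h3.summable, ?_⟩
  rw [HH, h3.tsum_eq]
  exact hS.hasSum.prod_fiberwise hrow

lemma hh_nonneg {x : ℝ} (hx : 0 < x) : 0 ≤ hh x := by
  have := Real.log_nonpos (x := 1 - Real.exp (-x))
    (by linarith [Real.exp_lt_one_iff.mpr (show -x < 0 by linarith)]) (by linarith [Real.exp_pos (-x)])
  rw [hh]; linarith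

lemma hh_le {x : ℝ} (hx : 0 < x) : hh x ≤ (Real.exp x - 1)⁻¹ := by
  have h1 : Real.exp (-x) < 1 := Real.exp_lt_one_iff.mpr (by linarith)
  have h2 := Real.one_sub_inv_le_log_of_pos (x := 1 - Real.exp (-x)) (by linarith)
  have h3 : Real.exp x - 1 ≠ 0 := by have := Real.add_one_lt_exp hx.ne'; linarith
  have h4 : (1 - Real.exp (-x)) ≠ 0 := by linarith
  have h5 : Real.exp x * Real.exp (-x) = 1 := by rw [← Real.exp_add]; simp
  have : (Real.exp x - 1)⁻¹ = (1 - Real.exp (-x))⁻¹ - 1 := by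
    rw [inv_eq_iff_eq_inv, eq_comm, inv_eq_iff_eq_inv]
    field_simp
    linear_combination h5
  rw [this, hh]; linarith

lemma hh_le' {x : ℝ} (hx : 1 ≤ x) : hh x ≤ Real.exp (-(x / 4)) ^ 2 := by
  have h0 : 0 < x := by linarith
  refine (hh_le h0).trans (le_trans ?_ (bose_le h0))
  have : 0 ≤ (Real.exp x - 1)⁻¹ := inv_nonneg.mpr (by linarith [Real.add_one_le_exp x])
  nlinarith

noncomputable def gset (α : ℝ) (n : ℕ) : Finset ℕ := (Finset.range n).filter fun m => bt α (m + 1) ≤ n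

lemma bset_eq {α : ℝ} (hα : 1 < α) (n : ℕ) : bset α n = (gset α n).image fun m => bt α (m + 1) := by
  ext a
  rw [mem_bset, Finset.mem_image]
  constructor
  · rintro ⟨⟨h1, h2⟩, m, hm, rfl⟩
    refine ⟨m - 1, ?_, by rw [Nat.sub_add_cancel hm]⟩
    rw [gset, Finset.mem_filter, Finset.mem_range, Nat.sub_add_cancel hm]
    have := le_bt hα m
    exact ⟨by omega, h2⟩
  · rintro ⟨m, hm, rfl⟩
    rw [gset, Finset.mem_filter, Finset.mem_range] at hm
    have := le_bt hα (m + 1)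
    exact ⟨⟨by omega, hm.2⟩, m + 1, by omega, rfl⟩

lemma HS_eq {α : ℝ} (hα : 1 < α) (n : ℕ) (t : ℝ) :
    HS (bset α n) t = ∑ m ∈ gset α n, hh (t * bt α (m + 1)) := by
  rw [HS, bset_eq hα, Finset.sum_image]
  intro x _ y _ h
  have := (bt_strictMono hα).injective h
  omega

lemma bt_succ_pos {α : ℝ} (hα : 1 < α) (m : ℕ) : 0 < bt α (m + 1) :=
  lt_of_lt_of_le (by omega) (le_bt hα (m + 1))

lemma HS_le {α t : ℝ} (hα : 1 < α) (ht : 0 < t) (n : ℕ) : HS (bset α n) t ≤ HH α t := by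
  rw [HS_eq hα]
  refine (HH_eq hα ht).1.sum_le_tsum _ fun m _ => hh_nonneg ?_
  have := bt_succ_pos hα m
  positivity

lemma le_HS {α t : ℝ} (hα : 1 < α) (ht : 0 < t) {n : ℕ} (hn : 1 ≤ t * n) :
    HH α t ≤ HS (bset α n) t + 16 / (t ^ 2 * n) := by
  have hn0 : (0:ℝ) < n := by
    by_contra h
    push Not at h
    nlinarith
  set G := gset α n with hG
  have h1 : HasSum (fun m => if m ∈ G then hh (t * bt α (m + 1)) else 0)
      (∑ m ∈ G, if m ∈ G then hh (t * bt α (m + 1)) else 0) :=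
    hasSum_sum_of_ne_finset_zero fun m hm => by rw [if_neg hm]
  have h2 : (∑ m ∈ G, if m ∈ G then hh (t * bt α (m + 1)) else 0) = HS (bset α n) t := by
    rw [HS_eq hα]; exact Finset.sum_congr rfl fun m hm => by rw [if_pos hm]
  rw [h2] at h1
  have ht4 : 0 < t / 4 := by positivity
  have h3 := (hasSum_exp_pos ht4).mul_left (Real.exp (-(t * n / 4)))
  have h4 := h1.add h3
  have hle : HH α t ≤ HS (bset α n) t + Real.exp (-(t * n / 4)) * (Real.exp (t / 4) - 1)⁻¹ := by
    rw [← h4.tsum_eq]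
    refine Summable.tsum_le_tsum (fun m => ?_) (HH_eq hα ht).1 h4.summable
    split_ifs with hm
    · have : 0 ≤ Real.exp (-(t * n / 4)) * Real.exp (-(t / 4 * (m + 1 : ℕ))) := by positivity
      linarith
    · rw [zero_add]
      have hmb : (m + 1 : ℕ) ≤ bt α (m + 1) := le_bt hα (m + 1)
      have hb : n < bt α (m + 1) := by
        by_contra h
        apply hm
        rw [hG, gset, Finset.mem_filter, Finset.mem_range]
        exact ⟨by omega, by omega⟩
      have hb' : (n:ℝ) ≤ bt α (m + 1) := by exact_mod_cast hb.le
      have hmb' : ((m + 1 : ℕ) : ℝ) ≤ bt α (m + 1) := by exact_mod_cast hmb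
      have hx : t * n ≤ t * bt α (m + 1) := by gcongr
      refine (hh_le' (hn.trans hx)).trans ?_
      rw [_root_.sq]
      gcongr ?_ * ?_
      · exact Real.exp_le_exp.mpr (by linarith)
      · apply Real.exp_le_exp.mpr
        have : t / 4 * ((m + 1 : ℕ) : ℝ) ≤ t / 4 * bt α (m + 1) := by gcongr
        linarith
  refine hle.trans (add_le_add le_rfl ?_)
  have h5 : Real.exp (-(t * n / 4)) ≤ (t * n / 4)⁻¹ := by
    rw [Real.exp_neg]
    exact inv_anti₀ (by positivity) (by linarith [Real.add_one_le_exp (t * n / 4)])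
  calc Real.exp (-(t * n / 4)) * (Real.exp (t / 4) - 1)⁻¹ ≤ (t * n / 4)⁻¹ * (1 / (t / 4)) := by
        gcongr
        · exact inv_nonneg.mpr (by linarith [Real.add_one_le_exp (t / 4)])
        · exact exp_sub_one_inv_le ht4
    _ = 16 / (t ^ 2 * n) := by field_simp; norm_num

lemma HH_asymp {α : ℝ} (hα : 1 < α) (hirr : Irrational α) {ε : ℝ} (hε : 0 < ε) :
    ∃ C t₁ : ℝ, 0 < t₁ ∧ ∀ t, 0 < t → t ≤ t₁ →
      |HH α t - π ^ 2 / (6 * α * t) - (1 / 2 - 1 / (2 * α)) * Real.log t| ≤ ε * (-Real.log t) + C := by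
  have hα0 : 0 < α := by linarith
  set β := 1 / 2 - 1 / (2 * α) with hβ
  have hβ0 : 0 ≤ β := by
    have : 1 / (2 * α) ≤ 1 / 2 := one_div_le_one_div_of_le (by norm_num) (by linarith)
    rw [hβ]; linarith
  have hlim := EE_tendsto hα hirr
  rw [← hβ, Metric.tendsto_nhdsWithin_nhds] at hlim
  obtain ⟨d, hd, hlim⟩ := hlim ε hε
  set s₀ := d / 2 with hs₀d
  have hs₀ : 0 < s₀ := by positivity
  have hs : ∀ s, 0 < s → s ≤ s₀ → |EE α s - 1 / (α * s) + β| ≤ ε := by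
    intro s h1 h2
    have := hlim (x := s) h1 (by rw [Real.dist_eq, sub_zero, abs_of_pos h1]; linarith)
    rw [Real.dist_eq, sub_neg_eq_add] at this
    exact this.le
  refine ⟨(β + ε) * (1 + |Real.log s₀|) + 2 / s₀, s₀, hs₀, fun t ht hts => ?_⟩
  set K := ⌊s₀ / t⌋₊ with hK
  have hst : 1 ≤ s₀ / t := by rw [le_div_iff₀ ht]; linarith
  have hK1 : 1 ≤ K := Nat.le_floor (by simpa using hst)
  have hKle : (K:ℝ) ≤ s₀ / t := Nat.floor_le (by positivity)
  have hKlt : s₀ / t < K + 1 := Nat.lt_floor_add_one _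
  have hK1' : (1:ℝ) ≤ K := by exact_mod_cast hK1
  -- the series
  set g : ℕ → ℝ := fun k => EE α ((k + 1) * t) / (k + 1) - 1 / ((k : ℝ) + 1) ^ 2 * (1 / (α * t)) with hg
  have hgs : HasSum g (HH α t - π ^ 2 / 6 * (1 / (α * t))) :=
    (HH_eq hα ht).2.sub (hasSum_zeta'.mul_right _)
  have hgform : ∀ k : ℕ, g k = (1 / ((k:ℝ) + 1)) * (EE α ((k + 1) * t) - 1 / (α * ((k + 1) * t))) := by
    intro k; rw [hg]; simp only; field_simp
  have hgb : ∀ k : ℕ, |g k| ≤ 1 / ((k:ℝ) + 1) ^ 2 * (1 / t) := by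
    intro k
    have hsk : 0 < ((k:ℝ) + 1) * t := by positivity
    rw [hgform, abs_mul, abs_of_pos (by positivity : 0 < 1 / ((k:ℝ) + 1))]
    have h1 := EE_nonneg α (((k:ℝ) + 1) * t)
    have h2 := EE_le hα hsk
    have h3 : 0 ≤ 1 / (α * (((k:ℝ) + 1) * t)) := by positivity
    have h4 : 1 / (α * (((k:ℝ) + 1) * t)) ≤ 1 / (((k:ℝ) + 1) * t) :=
      one_div_le_one_div_of_le hsk (by nlinarith)
    calc _ ≤ 1 / ((k:ℝ) + 1) * (1 / (((k:ℝ) + 1) * t)) := by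
          gcongr
          rw [abs_le]; constructor <;> linarith
      _ = _ := by field_simp
  have hharm : ((harmonic K : ℚ) : ℝ) = ∑ k ∈ Finset.range K, 1 / ((k:ℝ) + 1) := by
    rw [harmonic]; push_cast; simp
  set h := ((harmonic K : ℚ) : ℝ) with hh'
  have hfin : |∑ k ∈ Finset.range K, g k + β * h| ≤ ε * h := by
    rw [hharm, Finset.mul_sum, Finset.mul_sum, ← Finset.sum_add_distrib]
    refine (Finset.abs_sum_le_sum_abs _ _).trans (Finset.sum_le_sum fun k hk => ?_)
    have hk' : ((k:ℝ) + 1) ≤ K := by exact_mod_cast Finset.mem_range.mp hk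
    have h1 := hs (((k:ℝ) + 1) * t) (by positivity) (by
      calc ((k:ℝ) + 1) * t ≤ s₀ / t * t := by gcongr; linarith
        _ = s₀ := by field_simp)
    rw [hgform, mul_comm β, ← mul_add, abs_mul, abs_of_pos (by positivity : 0 < 1 / ((k:ℝ) + 1)), mul_comm ε]
    gcongr
  have htail : |∑' k, g (k + K)| ≤ 2 / s₀ := by
    have hzs : Summable fun k : ℕ => 1 / (((k + K : ℕ) : ℝ) + 1) ^ 2 * (1 / t) :=
      ((summable_nat_add_iff K).mpr hasSum_zeta'.summable).mul_right _
    have h1 : |∑' k, g (k + K)| ≤ ∑' k : ℕ, 1 / (((k + K : ℕ) : ℝ) + 1) ^ 2 * (1 / t) := by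
      rw [← Real.norm_eq_abs]
      exact tsum_of_norm_bounded hzs.hasSum fun k => hgb (k + K)
    refine h1.trans ?_
    rw [tsum_mul_right]
    calc _ ≤ 1 / (K:ℝ) * (1 / t) := by gcongr; exact tail_zeta hK1
      _ = 1 / (K * t) := by field_simp
      _ ≤ 1 / (s₀ / 2) := by
          apply one_div_le_one_div_of_le (by positivity)
          rw [div_lt_iff₀ ht] at hKlt
          nlinarith
      _ = 2 / s₀ := by field_simp
  have hsplit : HH α t - π ^ 2 / 6 * (1 / (α * t)) = ∑ k ∈ Finset.range K, g k + ∑' k, g (k + K) := by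
    rw [hgs.summable.sum_add_tsum_nat_add K, hgs.tsum_eq]
  have hlog : Real.log (s₀ / t) = Real.log s₀ - Real.log t := Real.log_div hs₀.ne' ht.ne'
  have hh1 : Real.log s₀ - Real.log t ≤ h := by
    rw [← hlog]
    refine le_trans ?_ (log_add_one_le_harmonic K)
    apply Real.log_le_log (by positivity)
    push_cast; exact hKlt.le
  have hh2 : h ≤ 1 + (Real.log s₀ - Real.log t) := by
    rw [← hlog]
    refine (harmonic_le_one_add_log K).trans ?_
    gcongr
  have e : HH α t - π ^ 2 / (6 * α * t) - β * Real.log t =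
      (∑ k ∈ Finset.range K, g k + β * h) + ∑' k, g (k + K) - β * (h + Real.log t) := by
    have : π ^ 2 / (6 * α * t) = π ^ 2 / 6 * (1 / (α * t)) := by field_simp
    rw [this]
    linear_combination hsplit
  have hd1 : |h + Real.log t| ≤ 1 + |Real.log s₀| := by
    have a1 := le_abs_self (Real.log s₀)
    have a2 := neg_abs_le (Real.log s₀)
    rw [abs_le]; constructor <;> linarith
  have hd2 : h ≤ -Real.log t + (1 + |Real.log s₀|) := by
    have a1 := le_abs_self (Real.log s₀)
    linarith
  rw [e]
  calc _ ≤ |∑ k ∈ Finset.range K, g k + β * h| + |∑' k, g (k + K)| + |β * (h + Real.log t)| :=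
        (abs_sub _ _).trans (add_le_add (abs_add_le _ _) le_rfl)
    _ ≤ ε * h + 2 / s₀ + β * (1 + |Real.log s₀|) := by
        rw [abs_mul, abs_of_nonneg hβ0]
        gcongr
    _ ≤ ε * (-Real.log t + (1 + |Real.log s₀|)) + 2 / s₀ + β * (1 + |Real.log s₀|) := by gcongr
    _ = _ := by ring

lemma window {α : ℝ} (hα : 1 < α) {τ : ℝ} (hτ : 0 < τ) (M : ℝ) :
    ∀ᶠ n : ℕ in atTop, 4 * α ≤ n ∧ 1 < Real.log n ∧ ∀ t : ℝ, 1 / (2 * √(α * n)) ≤ t → t ≤ 2 / √(n:ℝ) →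
      0 < t ∧ t ≤ τ ∧ M ≤ t * n ∧ 16 / (t ^ 2 * n) ≤ 64 * α ∧
      -(Real.log (2 * √α)) - Real.log n / 2 ≤ Real.log t ∧ Real.log t ≤ 0 := by
  have hcast : Tendsto (fun n : ℕ => (n:ℝ)) atTop atTop := tendsto_natCast_atTop_atTop
  have hlog : Tendsto (fun n : ℕ => Real.log n) atTop atTop := Real.tendsto_log_atTop.comp hcast
  have hsq : Tendsto (fun n : ℕ => √(n:ℝ)) atTop atTop := Real.tendsto_sqrt_atTop.comp hcast
  have hα0 : 0 < α := by linarith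
  have hsα : 0 < √α := Real.sqrt_pos.mpr hα0
  filter_upwards [hcast.eventually_ge_atTop (4 * α), hlog.eventually_gt_atTop 1,
    hsq.eventually_ge_atTop (2 / τ), hsq.eventually_ge_atTop (M * (2 * √α)), hsq.eventually_ge_atTop 2]
    with n h1 h2 h3 h4 h5
  refine ⟨h1, h2, fun t ht1 ht2 => ?_⟩
  have hn0 : (0:ℝ) < n := by linarith
  have hsn : 0 < √(n:ℝ) := Real.sqrt_pos.mpr hn0
  rw [Real.sqrt_mul hα0.le] at ht1
  have ht0 : 0 < t := lt_of_lt_of_le (by positivity) ht1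
  have hnn : √(n:ℝ) * √(n:ℝ) = n := Real.mul_self_sqrt hn0.le
  have hαα : √α * √α = α := Real.mul_self_sqrt hα0.le
  have hkey : √(n:ℝ) ≤ t * n * (2 * √α) := by
    rw [div_le_iff₀ (by positivity)] at ht1
    calc √(n:ℝ) = 1 * √(n:ℝ) := by ring
      _ ≤ t * (2 * (√α * √(n:ℝ))) * √(n:ℝ) := by gcongr
      _ = t * (√(n:ℝ) * √(n:ℝ)) * (2 * √α) := by ring
      _ = _ := by rw [hnn]
  refine ⟨ht0, ?_, ?_, ?_, ?_, ?_⟩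
  · refine ht2.trans ?_
    rw [div_le_iff₀ hsn]
    rw [div_le_iff₀ hτ] at h3
    linarith
  · have : M * (2 * √α) ≤ t * n * (2 * √α) := h4.trans hkey
    exact le_of_mul_le_mul_right this (by positivity)
  · rw [div_le_iff₀ (by positivity)]
    have h6 : √(n:ℝ) * √(n:ℝ) ≤ (t * n * (2 * √α)) * (t * n * (2 * √α)) := by gcongr
    have h7 : (t * n * (2 * √α)) * (t * n * (2 * √α)) = (4 * α * (t ^ 2 * n)) * n := by
      rw [show (t * n * (2 * √α)) * (t * n * (2 * √α)) = 4 * (√α * √α) * (t ^ 2 * n) * n by ring, hαα]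
    rw [hnn, h7] at h6
    have : 1 ≤ 4 * α * (t ^ 2 * n) := by
      by_contra hcon
      push Not at hcon
      nlinarith
    linarith
  · have h8 := Real.log_le_log (by positivity) ht1
    rw [one_div, Real.log_inv, show 2 * (√α * √(n:ℝ)) = (2 * √α) * √(n:ℝ) by ring,
      Real.log_mul (by positivity) (by positivity), Real.log_sqrt hn0.le] at h8
    linarith
  · apply Real.log_nonpos ht0.le
    refine ht2.trans ?_
    rw [div_le_one hsn]; exact h5

lemma kappa_eq {α : ℝ} (hα : 1 < α) : (1 / 2 - 1 / (2 * α)) + 3 / 2 = 2 * (1 - 1 / (4 * α)) := by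
  have : α ≠ 0 := by linarith
  field_simp
  ring

lemma log_aux (X q : ℝ) {p : ℝ} (hp : 0 < p) {v : ℝ} (hv : 0 < v) :
    Real.log (Real.exp X / p * (Real.exp q * v)) = X - Real.log p + (q + Real.log v) := by
  rw [Real.log_mul (by positivity) (by positivity), Real.log_div (by positivity) (by positivity),
    Real.log_exp, Real.log_mul (by positivity) (by positivity), Real.log_exp]

lemma lower_final {α : ℝ} (hα : 1 < α) (hirr : Irrational α) {ε : ℝ} (hε : 0 < ε) :
    ∃ C : ℝ, ∀ᶠ n : ℕ in atTop, 0 < beattyPartitions α n ∧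
      2 * π * √(n / (6 * α)) - (1 - 1 / (4 * α)) * Real.log n - ε * Real.log n - C ≤
        Real.log (beattyPartitions α n) := by
  obtain ⟨u₀, hu₀, hlow⟩ := pcnt_lower hα hirr
  obtain ⟨C₁, t₁, ht₁, hH⟩ := HH_asymp hα hirr hε
  set κ := 1 - 1 / (4 * α) with hκ
  have hα0 : 0 < α := by linarith
  have hκ0 : 0 < κ := by
    have : 1 / (4 * α) < 1 := by rw [div_lt_one (by positivity)]; linarith
    rw [hκ]; linarith
  set c := Real.log (2 * √α)
  refine ⟨(2 * κ + ε) * c + C₁ + 64 * α + 10 + Real.log (2 * π), ?_⟩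
  filter_upwards [window hα (τ := min t₁ (u₀ ^ 10)) (by positivity) (max 1 (2 * α))] with n hn
  obtain ⟨hn4, hn1, hw⟩ := hn
  obtain ⟨t, hl, hr, hmean⟩ := exists_tn hα hn4
  obtain ⟨ht0, htτ, htn, h64, hlogt, hlogt0⟩ := hw t hl hr
  have hn0 : (0:ℝ) < n := by linarith
  set u := t ^ ((1:ℝ) / 10) with hu
  have hu0 : 0 < u := Real.rpow_pos_of_pos ht0 _
  have hu10 : u ^ 10 = t := by
    rw [hu, ← Real.rpow_natCast, ← Real.rpow_mul ht0.le]; norm_num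
  have huu : u ≤ u₀ := by
    have : u ^ 10 ≤ u₀ ^ 10 := by rw [hu10]; exact htτ.trans (min_le_right _ _)
    exact le_of_pow_le_pow_left₀ (by norm_num) hu₀.le this
  have hmain := hlow u hu0 huu n (by
    rw [hu10, div_le_iff₀ ht0]
    have := (le_max_right 1 (2 * α)).trans htn
    linarith) (by rw [hu10]; exact hmean)
  rw [hu10] at hmain
  have hpos : 0 < Real.exp (HS (bset α n) t + n * t) / (2 * π) * (Real.exp (-10) * u ^ 15) := by positivity
  have hp : 0 < (pcnt (bset α n) n : ℝ) := lt_of_lt_of_le hpos hmain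
  rw [beatty_eq_pcnt hα]
  refine ⟨by exact_mod_cast hp, ?_⟩
  refine le_trans ?_ (Real.log_le_log hpos hmain)
  have hlu : Real.log (u ^ 15) = 3 / 2 * Real.log t := by
    rw [Real.log_pow, hu, Real.log_rpow ht0]; push_cast; ring
  rw [log_aux _ _ (by positivity) (by positivity), hlu]
  have h1 := le_HS hα ht0 ((le_max_left 1 (2 * α)).trans htn)
  have h2 := (abs_le.mp (hH t ht0 (htτ.trans (min_le_left _ _)))).1
  have hAG : 2 * π * √(n / (6 * α)) ≤ π ^ 2 / (6 * α * t) + n * t := by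
    set y := √((n:ℝ) / (6 * α)) with hy
    have hy2 : (n:ℝ) = 6 * α * y ^ 2 := by
      rw [hy, Real.sq_sqrt (by positivity)]; field_simp
    have : π ^ 2 / (6 * α * t) + n * t - 2 * π * y = (π - 6 * α * y * t) ^ 2 / (6 * α * t) := by
      rw [hy2]; field_simp; ring
    have : 0 ≤ (π - 6 * α * y * t) ^ 2 / (6 * α * t) := by positivity
    linarith
  have hk := kappa_eq hα
  rw [← hκ] at hk
  have h3 : (2 * κ + ε) * (-c - Real.log n / 2) ≤ (2 * κ + ε) * Real.log t := by gcongr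
  have h4 : (1 / 2 - 1 / (2 * α)) * Real.log t + 3 / 2 * Real.log t = 2 * κ * Real.log t := by
    rw [← hk]; ring
  have h5 : 0 ≤ ε * Real.log n := by positivity
  linarith

lemma upper_final {α : ℝ} (hα : 1 < α) (hirr : Irrational α) {ε : ℝ} (hε : 0 < ε) :
    ∃ C : ℝ, ∀ᶠ n : ℕ in atTop, 0 < beattyPartitions α n →
      Real.log (beattyPartitions α n) ≤
      2 * π * √(n / (6 * α)) - (1 - 1 / (4 * α)) * Real.log n + ε * Real.log n + C := by
  obtain ⟨C₀, hC₀, t₀, ht₀, hup⟩ := pcnt_upper hα hirr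
  obtain ⟨C₁, t₁, ht₁, hH⟩ := HH_asymp hα hirr hε
  set κ := 1 - 1 / (4 * α) with hκ
  have hα0 : 0 < α := by linarith
  set c := Real.log (2 * √α)
  set ρ := Real.log π - Real.log (6 * α) / 2 with hρ
  refine ⟨2 * κ * ρ + ε * c + C₁ + Real.log C₀, ?_⟩
  filter_upwards [window hα (τ := min t₁ t₀) (by positivity) (2 * α)] with n hn hppos
  obtain ⟨hn4, hn1, hw⟩ := hn
  have hn0 : (0:ℝ) < n := by linarith
  set r := √(6 * α * n) with hrd
  have hr0 : 0 < r := by positivity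
  have hr2 : r * r = 6 * α * n := Real.mul_self_sqrt (by positivity)
  set t := π / r with ht
  have hpi := Real.pi_gt_three
  have hpi4 := Real.pi_le_four
  have hl : 1 / (2 * √(α * n)) ≤ t := by
    rw [ht, div_le_div_iff₀ (by positivity) hr0]
    have : r ≤ 3 * √(α * n) := by
      rw [hrd]
      apply Real.sqrt_le_iff.mpr
      refine ⟨by positivity, ?_⟩
      rw [mul_pow, Real.sq_sqrt (by positivity)]
      nlinarith [mul_pos hα0 hn0]
    have h0 := Real.sqrt_nonneg (α * n)
    nlinarith
  have hr : t ≤ 2 / √(n:ℝ) := by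
    rw [ht, div_le_div_iff₀ hr0 (by positivity)]
    have : 2 * √(n:ℝ) ≤ r := by
      rw [hrd]
      apply Real.le_sqrt_of_sq_le
      rw [mul_pow, Real.sq_sqrt hn0.le]
      nlinarith
    have h0 := Real.sqrt_nonneg (n:ℝ)
    nlinarith
  obtain ⟨ht0, htτ, htn, h64, hlogt, hlogt0⟩ := hw t hl hr
  have hmain := hup t ht0 (htτ.trans (min_le_right _ _)) n (by rw [div_le_iff₀ ht0]; linarith)
  rw [beatty_eq_pcnt hα] at hppos ⊢
  refine (Real.log_le_log (by exact_mod_cast hppos) hmain).trans ?_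
  rw [Real.log_mul (by positivity) (by positivity), Real.log_mul (by positivity) (by positivity),
    Real.log_exp, Real.log_mul (by positivity) (by positivity), Real.log_sqrt ht0.le]
  have h1 := HS_le hα ht0 n
  have h2 := (abs_le.mp (hH t ht0 (htτ.trans (min_le_left _ _)))).2
  have hy : √((n:ℝ) / (6 * α)) = r / (6 * α) := by
    rw [show (n:ℝ) / (6 * α) = (r / (6 * α)) ^ 2 by
      rw [div_pow, _root_.sq r, hr2]; field_simp]
    exact Real.sqrt_sq (by positivity)
  have hAG : 2 * π * √(n / (6 * α)) = π ^ 2 / (6 * α * t) + n * t := by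
    rw [hy, ht]
    have : (n:ℝ) = r * r / (6 * α) := by rw [hr2]; field_simp
    rw [this]; field_simp; ring
  have hlt : Real.log t = ρ - Real.log n / 2 := by
    rw [ht, Real.log_div (by positivity) (by positivity), hrd, Real.log_sqrt (by positivity),
      Real.log_mul (by positivity) (by positivity), hρ]; ring
  have hk := kappa_eq hα
  rw [← hκ] at hk
  have h3 : ε * (-c - Real.log n / 2) ≤ ε * Real.log t := by gcongr
  have h4 : (1 / 2 - 1 / (2 * α)) * Real.log t + 3 / 2 * Real.log t = 2 * κ * (ρ - Real.log n / 2) := by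
    rw [← hlt, ← hk]; ring
  have h5 : 0 ≤ ε * Real.log n := by positivity
  linarith

theorem stmt1 (α : ℝ) (hα : 1 < α) (hirr : Irrational α) :
    Tendsto (fun n : ℕ =>
        (Real.log (beattyPartitions α n) - 2 * π * Real.sqrt (n / (6 * α))) / Real.log n)
      atTop (𝓝 (-(1 - 1 / (4 * α)))) := by
  rw [Metric.tendsto_nhds]
  intro ε hε
  have hε3 : 0 < ε / 3 := by positivity
  obtain ⟨C₁, h₁⟩ := lower_final hα hirr hε3
  obtain ⟨C₂, h₂⟩ := upper_final hα hirr hε3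
  have hlog : Tendsto (fun n : ℕ => Real.log n) atTop atTop :=
    Real.tendsto_log_atTop.comp tendsto_natCast_atTop_atTop
  filter_upwards [h₁, h₂, hlog.eventually_gt_atTop 0, hlog.eventually_ge_atTop (C₁ / (ε / 3)),
    hlog.eventually_ge_atTop (C₂ / (ε / 3))] with n a1 a2 a3 a4 a5
  have a6 := a2 a1.1
  have a7 := a1.2
  rw [div_le_iff₀ hε3] at a4 a5
  rw [Real.dist_eq, abs_lt]
  set L := Real.log n
  set P := Real.log (beattyPartitions α n)
  set X := 2 * π * √((n:ℝ) / (6 * α))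
  set κ := 1 - 1 / (4 * α)
  have e : (P - X) / L - -κ = (P - X + κ * L) / L := by field_simp; ring
  have hp : 0 < ε * L := by positivity
  rw [e]
  constructor
  · rw [lt_div_iff₀ a3]; linarith
  · rw [div_lt_iff₀ a3]; linarith
end

section
/- Let α > 1 be an irrational real number. Suppose there exists a function ψ : ℝ₊ → ℝ₊ which is decreasing for all sufficiently large x, such that ∫₁^∞ ψ(x)/x dx < ∞ and q^{−1}·‖qα‖ > e^{−q·ψ(q)} for all integers q ≥ 1. Then there exist constants c₀ > 0 and C > 0 such that |∑_{1 ≤ ℓ ≤ x} B̃₁(αℓ)| ≤ C · x · ψ(c₀ log x)/log x for all sufficiently large x. -/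
open Filter Topology Real MeasureTheory

lemma perm_sum (a b : ℤ) (q : ℕ) (hq : 0 < q) (cop : IsCoprime a (q : ℤ)) (g : ℕ → ℝ) :
    ∑ j ∈ Finset.range q, g (((b + a * j) % q).toNat) = ∑ s ∈ Finset.range q, g s := by
  have hq' : (0 : ℤ) < q := by exact_mod_cast hq
  have hmaps : ∀ j ∈ Finset.range q, ((b + a * (j : ℤ)) % q).toNat ∈ Finset.range q := by
    intro j _
    have h1 := Int.emod_nonneg (b + a * (j : ℤ)) hq'.ne'
    have h2 := Int.emod_lt_of_pos (b + a * (j : ℤ)) hq'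
    rw [Finset.mem_range]; omega
  have hinj : Set.InjOn (fun j : ℕ => ((b + a * (j : ℤ)) % q).toNat) (Finset.range q : Set ℕ) := by
    intro i hi j hj hij
    simp only [Finset.coe_range, Set.mem_Iio] at hi hj
    have h1 := Int.emod_nonneg (b + a * (i : ℤ)) hq'.ne'
    have h2 := Int.emod_nonneg (b + a * (j : ℤ)) hq'.ne'
    have h3 : (b + a * (i : ℤ)) % q = (b + a * (j : ℤ)) % q := by
      simp only at hij; omega
    have h4 : (q : ℤ) ∣ a * ((j : ℤ) - i) := by
      have h5 := Int.ModEq.dvd (show (b + a * (i : ℤ)) ≡ (b + a * (j : ℤ)) [ZMOD q] from h3)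
      convert h5 using 1; ring
    have h6 : (q : ℤ) ∣ (j : ℤ) - i := cop.symm.dvd_of_dvd_mul_left h4
    have h7 : (j : ℤ) - i = 0 := Int.eq_zero_of_abs_lt_dvd h6 (by rw [abs_lt]; omega)
    omega
  have hsurj := Finset.surjOn_of_injOn_of_card_le _ hmaps hinj le_rfl
  exact Finset.sum_nbij _ hmaps hinj hsurj (fun _ _ => rfl)

lemma block (α β : ℝ) (a : ℤ) (q : ℕ) (hq : 0 < q) (cop : IsCoprime a (q : ℤ))
    (h : |q * α - a| * q ≤ 1) :
    |∑ j ∈ Finset.range q, (Int.fract (β + α * j) - 1 / 2)| ≤ 5 := by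
  have hq' : (0 : ℤ) < q := by exact_mod_cast hq
  have hqr : (0 : ℝ) < q := by exact_mod_cast hq
  set b := ⌊q * β⌋ with hb
  let G : ℕ → ℝ := fun s => 2 / q + (if s = 0 then 1 else 0) + (if s = q - 1 then 1 else 0)
  have key : ∀ j ∈ Finset.range q,
      |Int.fract (β + α * j) - ((((b + a * j) % q).toNat : ℕ) : ℝ) / q|
        ≤ G (((b + a * j) % q).toNat) := by
    intro j hj
    have hjq : (j : ℝ) < q := by exact_mod_cast Finset.mem_range.1 hj
    have h1 := Int.emod_nonneg (b + a * (j : ℤ)) hq'.ne'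
    have h2 := Int.emod_lt_of_pos (b + a * (j : ℤ)) hq'
    have h3 := Int.emod_add_mul_ediv (b + a * (j : ℤ)) q
    generalize (b + a * (j : ℤ)) / q = k at h3
    obtain ⟨s, hs⟩ := Int.eq_ofNat_of_zero_le h1
    rw [hs] at h2 h3 ⊢
    simp only [Int.toNat_natCast]
    have hsq : s < q := by exact_mod_cast h2
    have hsr : (s : ℝ) < q := by exact_mod_cast hsq
    have hs1 : (s : ℝ) + 1 ≤ q := by exact_mod_cast hsq
    have h3r : (s : ℝ) + q * k = b + a * j := by exact_mod_cast h3
    have hb1 : (b : ℝ) ≤ q * β := Int.floor_le _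
    have hb2 : q * β < b + 1 := Int.lt_floor_add_one _
    have hw : |(q * α - a) * j| ≤ 1 := by
      rw [abs_mul, Nat.abs_cast]
      exact le_trans (mul_le_mul_of_nonneg_left hjq.le (abs_nonneg _)) h
    rw [abs_le] at hw
    set v := q * β - b + (q * α - a) * j with hv
    have hy : β + α * j = ((s : ℝ) + v) / q + k := by
      field_simp
      linarith
    rw [hy, Int.fract_add_intCast]
    have hv1 : -1 ≤ v := by linarith [hw.1]
    have hv2 : v < 2 := by linarith [hw.2]
    have hd0 : (0 : ℝ) ≤ 2 / q := by positivity
    have hs0 : (0 : ℝ) ≤ (s : ℝ) / q := by positivity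
    have hs2 : (s : ℝ) / q ≤ 1 := by rw [div_le_one hqr]; exact hsr.le
    have hf0 := Int.fract_nonneg (((s : ℝ) + v) / q)
    have hf1 := (Int.fract_lt_one (((s : ℝ) + v) / q)).le
    have htriv : |Int.fract (((s : ℝ) + v) / q) - (s : ℝ) / q| ≤ 1 := by
      rw [abs_le]; constructor <;> linarith
    simp only [G]
    by_cases c1 : s = 0
    · rw [if_pos c1]; split_ifs <;> linarith
    by_cases c2 : s = q - 1
    · rw [if_pos c2]; split_ifs; linarith
    rw [if_neg c1, if_neg c2]
    have e1 : (1 : ℝ) ≤ s := by exact_mod_cast Nat.one_le_iff_ne_zero.2 c1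
    have e2 : (s : ℝ) + 2 ≤ q := by
      have : s + 2 ≤ q := by omega
      exact_mod_cast this
    have e3 : Int.fract (((s : ℝ) + v) / q) = ((s : ℝ) + v) / q := by
      rw [Int.fract_eq_self]
      constructor
      · apply div_nonneg _ hqr.le; linarith
      · rw [div_lt_one hqr]; linarith
    rw [e3, ← sub_div, add_sub_cancel_left, abs_div, abs_of_pos hqr, add_zero, add_zero]
    apply div_le_div_of_nonneg_right _ hqr.le
    rw [abs_le]; constructor <;> linarith
  have hS1 : ∑ j ∈ Finset.range q, (((((b + a * j) % q).toNat : ℕ) : ℝ) / q - 1 / 2) = -1 / 2 := by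
    rw [perm_sum a b q hq cop (fun s => (s : ℝ) / q - 1 / 2)]
    rw [Finset.sum_sub_distrib, ← Finset.sum_div]
    have h1 := Finset.sum_range_id_mul_two q
    have h2 : (∑ i ∈ Finset.range q, (i : ℝ)) * 2 = q * (q - 1) := by
      have : (((∑ i ∈ Finset.range q, i) * 2 : ℕ) : ℝ) = ((q * (q - 1) : ℕ) : ℝ) := by rw [h1]
      rw [Nat.cast_mul, Nat.cast_mul, Nat.cast_sub hq] at this
      push_cast at this
      exact this
    have h3 : (∑ i ∈ Finset.range q, (i : ℝ)) = q * (q - 1) / 2 := by linarith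
    rw [h3]
    simp
    field_simp
    ring
  have hS2 : ∑ j ∈ Finset.range q, G (((b + a * j) % q).toNat) = 4 := by
    rw [perm_sum a b q hq cop G]
    simp only [G, Finset.sum_add_distrib]
    rw [Finset.sum_ite_eq' , Finset.sum_ite_eq', if_pos (Finset.mem_range.2 hq),
      if_pos (Finset.mem_range.2 (by omega))]
    simp
    field_simp
    norm_num
  have hS3 : ∑ j ∈ Finset.range q, (Int.fract (β + α * j) - 1 / 2) =
      ∑ j ∈ Finset.range q, (Int.fract (β + α * j) - ((((b + a * j) % q).toNat : ℕ) : ℝ) / q)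
      + ∑ j ∈ Finset.range q, (((((b + a * j) % q).toNat : ℕ) : ℝ) / q - 1 / 2) := by
    rw [← Finset.sum_add_distrib]
    apply Finset.sum_congr rfl
    intro j _; ring
  have hS4 := (Finset.abs_sum_le_sum_abs _ _).trans (Finset.sum_le_sum key)
  rw [hS2] at hS4
  rw [hS3, hS1]
  rw [abs_le] at hS4 ⊢
  constructor <;> linarith [hS4.1, hS4.2]

lemma full (α : ℝ) (a : ℤ) (q : ℕ) (hq : 0 < q) (cop : IsCoprime a (q : ℤ))
    (h : |q * α - a| * q ≤ 1) (N : ℕ) :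
    |∑ ℓ ∈ Finset.Icc 1 N, (Int.fract (α * ℓ) - 1 / 2)| ≤ 5 * (N / q) + q := by
  have hqr : (0 : ℝ) < q := by exact_mod_cast hq
  have e : ∀ N : ℕ, ∑ ℓ ∈ Finset.Icc 1 N, (Int.fract (α * ℓ) - 1 / 2)
      = ∑ i ∈ Finset.range N, (Int.fract (α * ((i + 1 : ℕ) : ℝ)) - 1 / 2) := by
    intro N
    induction N with
    | zero => simp
    | succ n ih => rw [Finset.sum_Icc_succ_top (by omega), ih, Finset.sum_range_succ]
  have hb : ∀ k : ℕ, |∑ i ∈ Finset.range (q * k), (Int.fract (α * ((i + 1 : ℕ) : ℝ)) - 1 / 2)|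
      ≤ 5 * k := by
    intro k
    induction k with
    | zero => simp
    | succ k ih =>
      rw [Nat.mul_succ, Finset.sum_range_add]
      have hB := block α (α * (q * k + 1)) a q hq cop h
      have e2 : ∑ j ∈ Finset.range q, (Int.fract (α * ((q * k + j + 1 : ℕ) : ℝ)) - 1 / 2)
          = ∑ j ∈ Finset.range q, (Int.fract (α * (q * k + 1) + α * j) - 1 / 2) := by
        apply Finset.sum_congr rfl
        intro j _
        congr 2
        push_cast; ring
      rw [e2]
      refine (abs_add_le _ _).trans ?_
      rw [Nat.cast_succ]
      linarith
  rw [e]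
  have hN := Nat.div_add_mod N q
  rw [← hN, Finset.sum_range_add, hN]
  refine (abs_add_le _ _).trans ?_
  have h1 := hb (N / q)
  have h2 : ((N / q : ℕ) : ℝ) ≤ (N : ℝ) / q := Nat.cast_div_le
  have h3 : |∑ j ∈ Finset.range (N % q), (Int.fract (α * ((q * (N / q) + j + 1 : ℕ) : ℝ)) - 1 / 2)|
      ≤ ((N % q : ℕ) : ℝ) := by
    refine (Finset.abs_sum_le_sum_abs _ _).trans ?_
    refine (Finset.sum_le_card_nsmul _ _ 1 ?_).trans (by simp)
    intro j _
    have := Int.fract_nonneg (α * ((q * (N / q) + j + 1 : ℕ) : ℝ))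
    have := Int.fract_lt_one (α * ((q * (N / q) + j + 1 : ℕ) : ℝ))
    rw [abs_le]; constructor <;> linarith
  have h4 : ((N % q : ℕ) : ℝ) ≤ q := by exact_mod_cast (Nat.mod_lt N hq).le
  linarith

theorem stmt4 (α : ℝ) (hα : 1 < α) (hirr : Irrational α)
    (ψ : ℝ → ℝ) (hψpos : ∀ x > 0, 0 < ψ x)
    (hψdec : ∃ X : ℝ, ∀ ⦃x y : ℝ⦄, X ≤ x → x ≤ y → ψ y ≤ ψ x)
    (hψint : IntegrableOn (fun x => ψ x / x) (Set.Ici 1))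
    (happrox : ∀ q : ℕ, 1 ≤ q →
      Real.exp (-(q * ψ q)) < (q : ℝ)⁻¹ * |(q : ℝ) * α - round ((q : ℝ) * α)|) :
    ∃ c₀ > (0 : ℝ), ∃ C > (0 : ℝ), ∀ᶠ x : ℝ in atTop,
      |∑ ℓ ∈ Finset.Icc 1 ⌊x⌋₊, (Int.fract (α * ℓ) - 1 / 2)| ≤
        C * (x * ψ (c₀ * Real.log x) / Real.log x) := by
  obtain ⟨X, hX⟩ := hψdec
  obtain ⟨M, hM1, hM⟩ : ∃ M : ℝ, 1 ≤ M ∧ ∀ q : ℕ, ψ q ≤ M := by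
    refine ⟨∑ i ∈ Finset.range (⌈X⌉₊ + 1), |ψ i| + 1, ?_, ?_⟩
    · have : 0 ≤ ∑ i ∈ Finset.range (⌈X⌉₊ + 1), |ψ i| := Finset.sum_nonneg fun _ _ => abs_nonneg _
      linarith
    · have hs : ∀ q : ℕ, q ≤ ⌈X⌉₊ → ψ q ≤ ∑ i ∈ Finset.range (⌈X⌉₊ + 1), |ψ i| + 1 := by
        intro q hq
        have := Finset.single_le_sum (f := fun i : ℕ => |ψ i|) (s := Finset.range (⌈X⌉₊ + 1))
          (fun _ _ => abs_nonneg _) (Finset.mem_range.2 (Nat.lt_succ_of_le hq))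
        have h2 := le_abs_self (ψ q)
        linarith
      intro q
      rcases le_total q ⌈X⌉₊ with hq | hq
      · exact hs q hq
      · exact (hX (Nat.le_ceil X) (by exact_mod_cast hq)).trans (hs _ le_rfl)
  have hM0 : 0 < M := by linarith
  set c := 1 / (2 * M) with hc
  have hc0 : 0 < c := by positivity
  have hcM : c * (2 * M) = 1 := by rw [hc]; field_simp
  have hc1 : c ≤ 1 / 2 := by nlinarith
  refine ⟨c, hc0, 11, by norm_num, ?_⟩
  have hlog : Tendsto (fun x => c * Real.log x) atTop atTop :=
    Real.tendsto_log_atTop.const_mul_atTop hc0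
  have hlo : ∀ᶠ x : ℝ in atTop, 2 * Real.log x ^ 2 ≤ √x := by
    have h1 := (isLittleO_log_rpow_atTop (r := 1 / 4) (by norm_num)).bound
      (show (0 : ℝ) < 1 / 2 by norm_num)
    filter_upwards [h1, eventually_ge_atTop 1] with x hx hx1
    have hp : 0 ≤ x ^ (1 / 4 : ℝ) := by positivity
    rw [Real.norm_eq_abs, Real.norm_eq_abs, abs_of_nonneg (Real.log_nonneg hx1),
      abs_of_nonneg hp] at hx
    have h2 : (x ^ (1 / 4 : ℝ)) ^ 2 = √x := by
      rw [← Real.rpow_natCast, ← Real.rpow_mul (by linarith), Real.sqrt_eq_rpow]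
      norm_num
    have h3 := Real.log_nonneg hx1
    nlinarith
  filter_upwards [hlog.eventually_ge_atTop (max X 1), hlo, eventually_ge_atTop 1] with x hxX hlx hx1
  have hLX : X ≤ c * Real.log x := (le_max_left _ _).trans hxX
  have hL1 : 1 ≤ c * Real.log x := (le_max_right _ _).trans hxX
  have hx0 : 0 < x := by linarith
  set L := Real.log x with hLdef
  have hL0 : 0 < L := by
    by_contra hcon
    push Not at hcon
    nlinarith
  have hP0 : 0 < ψ (c * L) := hψpos _ (by linarith)
  set P := ψ (c * L) with hP
  -- lower bound on P
  have hPlow : 1 ≤ P * (2 * L) := by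
    set n := ⌈c * L⌉₊ with hn
    have hn1 : c * L ≤ n := Nat.le_ceil _
    have hn2 : (n : ℝ) < c * L + 1 := Nat.ceil_lt_add_one (by linarith)
    have hnpos : (1 : ℝ) ≤ n := by linarith
    have h1 := happrox n (by exact_mod_cast hnpos)
    have h2 : (n : ℝ)⁻¹ * |(n : ℝ) * α - round ((n : ℝ) * α)| ≤ 1 * (1 / 2) :=
      mul_le_mul (inv_le_one_of_one_le₀ hnpos) (abs_sub_round _) (abs_nonneg _) zero_le_one
    have h3 := Real.add_one_le_exp (-(n * ψ n))
    have h4 : ψ n ≤ P := hX hLX hn1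
    have h5 : (n : ℝ) * ψ n ≤ n * P := mul_le_mul_of_nonneg_left h4 (by linarith)
    have h6 : n * P ≤ (2 * (c * L)) * P := mul_le_mul_of_nonneg_right (by linarith) hP0.le
    have h7 : c * (L * P) ≤ 1 / 2 * (L * P) := mul_le_mul_of_nonneg_right hc1 (by positivity)
    nlinarith
  have hsq1 : 1 ≤ √x := Real.one_le_sqrt.2 hx1
  have hsq2 : √x * √x = x := Real.mul_self_sqrt hx0.le
  have hQ : 0 < ⌊√x⌋₊ := Nat.floor_pos.2 hsq1
  obtain ⟨r, hr1, hr2⟩ := Real.exists_rat_abs_sub_le_and_den_le α hQ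
  have hQ1 : √x < ⌊√x⌋₊ + 1 := Nat.lt_floor_add_one _
  have hQ2 : (⌊√x⌋₊ : ℝ) ≤ √x := Nat.floor_le (by linarith)
  have hq := r.den_pos
  have cop : IsCoprime r.num (r.den : ℤ) := Rat.isCoprime_num_den r
  have hqQ : (r.den : ℝ) ≤ √x := le_trans (by exact_mod_cast hr2) hQ2
  have hqr : (0 : ℝ) < r.den := by exact_mod_cast hq
  have hq1 : (1 : ℝ) ≤ r.den := by exact_mod_cast hq
  have hnum : |r.den * α - r.num| ≤ 1 / (⌊√x⌋₊ + 1) := by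
    have e1 : (r.den : ℝ) * α - r.num = r.den * (α - r) := by
      have : (r : ℝ) = r.num / r.den := Rat.cast_def r
      rw [this]; field_simp
    rw [e1, abs_mul, Nat.abs_cast]
    calc (r.den : ℝ) * |α - r| ≤ r.den * (1 / ((⌊√x⌋₊ + 1) * r.den)) :=
          mul_le_mul_of_nonneg_left hr1 hqr.le
      _ = _ := by field_simp
  generalize r.den = q at *
  generalize r.num = a at *
  have hnum2 : |q * α - a| ≤ 1 / √x :=
    hnum.trans (one_div_le_one_div_of_le (by linarith) hQ1.le)
  have hmain := full α a q hq cop (by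
    calc |q * α - a| * q ≤ 1 / √x * √x := mul_le_mul hnum2 hqQ hqr.le (by positivity)
      _ = 1 := by field_simp) ⌊x⌋₊
  -- q ψ(q) ≥ L / 2
  have hqψ : L / 2 ≤ q * ψ q := by
    have h1 := happrox q hq
    have h2 : (q : ℝ)⁻¹ * |(q : ℝ) * α - round ((q : ℝ) * α)| ≤ 1 * (1 / √x) :=
      mul_le_mul (inv_le_one_of_one_le₀ hq1) ((round_le _ a).trans hnum2) (abs_nonneg _) zero_le_one
    have h3 : Real.exp (-(q * ψ q)) ≤ Real.exp (-(L / 2)) := by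
      rw [Real.exp_neg (L / 2), ← Real.log_sqrt hx0.le, Real.exp_log (by linarith), ← one_div]
      linarith
    have := Real.exp_le_exp.1 h3
    linarith
  have hqc : c * L ≤ q := by
    have h1 : (q : ℝ) * ψ q ≤ q * M := mul_le_mul_of_nonneg_left (hM q) hqr.le
    have h2 : c * L ≤ c * (2 * (q * M)) := mul_le_mul_of_nonneg_left (by linarith) hc0.le
    have h3 : c * (2 * (q * M)) = q := by
      calc c * (2 * (q * M)) = c * (2 * M) * q := by ring
        _ = q := by rw [hcM, one_mul]
    linarith
  have hqP : L / 2 ≤ q * P :=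
    hqψ.trans (mul_le_mul_of_nonneg_left (hX hLX hqc) hqr.le)
  have hfl : (⌊x⌋₊ : ℝ) ≤ x := Nat.floor_le hx0.le
  have b1 : (⌊x⌋₊ : ℝ) / q ≤ 2 * (x * P / L) := by
    have : (⌊x⌋₊ : ℝ) / q ≤ x / q := div_le_div_of_nonneg_right hfl hqr.le
    refine this.trans ?_
    rw [← mul_div_assoc, div_le_div_iff₀ hqr hL0]
    nlinarith
  have b2 : (q : ℝ) ≤ x * P / L := by
    refine hqQ.trans ?_
    rw [le_div_iff₀ hL0]
    have h1 : L ≤ √x * P := by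
      have h2 : 2 * L ^ 2 * P ≤ √x * P := mul_le_mul_of_nonneg_right hlx hP0.le
      nlinarith
    calc √x * L ≤ √x * (√x * P) := mul_le_mul_of_nonneg_left h1 (by linarith)
      _ = x * P := by rw [← mul_assoc, hsq2]
  linarith
end
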